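/- arXiv:1002.0628 — 3 statements merged into one kernel-verified Lean document; each statement's English description precedes it below -/
import Mathlib

section
/- Let 𝒞 = (V,ℛ) be a coherent configuration. Then 𝒞 is balanced (i.e., |ℛ_{X,Y}| is the same for all pairs of fibers X,Y) if and only if for each fiber X of 𝒞 the map P ↦ P_X = P·I_X is a well-defined bijection from 𝒫(𝒞) onto 𝒫(𝒞_X) and moreover n_P = |Fib(𝒞)|·n_{P_X} for every P ∈ 𝒫(𝒞). -/
open scoped Classical

namespace CCPaper

variable {V : Type*}

/-- The diagonal relation `Δ_X = {(x,x) : x ∈ X}` on a subset `X ⊆ V`. -/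
def diag (X : Set V) : Set (V × V) := {p : V × V | p.1 ∈ X ∧ p.1 = p.2}

/-- The transpose `R^t = {(v,u) : (u,v) ∈ R}` of a relation. -/
def transp (R : Set (V × V)) : Set (V × V) := Prod.swap ⁻¹' R

/-- The intersection number `|{w : (p.1,w) ∈ R, (w,p.2) ∈ S}|` at a pair `p`. -/
noncomputable def iNum (R S : Set (V × V)) (p : V × V) : ℕ :=
  Nat.card {w : V | (p.1, w) ∈ R ∧ (w, p.2) ∈ S}

/-- `ℛ` is a coherent configuration (scheme) on the finite set `V`:
(C1) `ℛ` consists of nonempty relations partitioning `V × V`;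
(C2) the diagonal is a union of relations of `ℛ`;
(C3) `ℛ` is closed under transposition;
(C4) intersection numbers are constant on each relation of `ℛ`. -/
def IsCC [Fintype V] (ℛ : Set (Set (V × V))) : Prop :=
  (∀ R ∈ ℛ, R.Nonempty) ∧
  (∀ p : V × V, ∃! R, R ∈ ℛ ∧ p ∈ R) ∧
  (∀ R ∈ ℛ, (∃ p ∈ R, p.1 = p.2) → ∀ p ∈ R, p.1 = p.2) ∧
  (∀ R ∈ ℛ, transp R ∈ ℛ) ∧
  (∀ R ∈ ℛ, ∀ S ∈ ℛ, ∀ T ∈ ℛ, ∀ p ∈ T, ∀ q ∈ T, iNum R S p = iNum R S q)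

/-- A fiber of the configuration: a nonempty `X ⊆ V` with `Δ_X ∈ ℛ`. -/
def IsFiber [Fintype V] (ℛ : Set (Set (V × V))) (X : Set V) : Prop :=
  X.Nonempty ∧ diag X ∈ ℛ

/-- `ℛ_{X,Y}`, the set of basis relations contained in `X × Y`. -/
def relsBtw [Fintype V] (ℛ : Set (Set (V × V))) (X Y : Set V) : Set (Set (V × V)) :=
  {R | R ∈ ℛ ∧ R ⊆ X ×ˢ Y}

/-- Out-degree `d_R = |R_out(x)|` (computed at a chosen point of `R`;
for a basis relation of a scheme this is independent of the point). -/
noncomputable def outDeg (R : Set (V × V)) : ℕ :=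
  if h : R.Nonempty then Nat.card {y : V | (h.choose.1, y) ∈ R} else 0

/-- In-degree `e_R = |R_in(y)|` (computed at a chosen point of `R`). -/
noncomputable def inDeg (R : Set (V × V)) : ℕ :=
  if h : R.Nonempty then Nat.card {x : V | (x, h.choose.2) ∈ R} else 0

/-- The structure constant `c_{RS}^T` (computed at a chosen pair of `T`). -/
noncomputable def sConst (R S T : Set (V × V)) : ℕ :=
  if h : T.Nonempty then iNum R S h.choose else 0

/-- The complex product `RS = {T ∈ ℛ : c_{RS}^T > 0}`. -/
def cProd [Fintype V] (ℛ : Set (Set (V × V))) (R S : Set (V × V)) : Set (Set (V × V)) :=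
  {T | T ∈ ℛ ∧ 0 < sConst R S T}

/-- A relation is thin if `d_R = e_R = 1`. -/
def IsThin (R : Set (V × V)) : Prop := outDeg R = 1 ∧ inDeg R = 1

/-- `ℛ` is `r`-balanced: `|ℛ_{X,Y}| = r` for all fibers `X, Y`. -/
def IsBalancedWith [Fintype V] (ℛ : Set (Set (V × V))) (r : ℕ) : Prop :=
  ∀ X Y : Set V, IsFiber ℛ X → IsFiber ℛ Y → Nat.card (relsBtw ℛ X Y) = r

/-- `ℛ` is balanced: `|ℛ_{X,Y}|` is the same for all pairs of fibers. -/
def IsBalanced [Fintype V] (ℛ : Set (Set (V × V))) : Prop := ∃ r : ℕ, IsBalancedWith ℛ r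

/-- An `(m,n,r)`-scheme: a coherent configuration which is `r`-balanced, all of whose
fibers have size `m`, and which has exactly `n` fibers. -/
def IsMNRScheme [Fintype V] (ℛ : Set (Set (V × V))) (m n r : ℕ) : Prop :=
  IsCC ℛ ∧ IsBalancedWith ℛ r ∧ (∀ X : Set V, IsFiber ℛ X → Nat.card X = m) ∧
    Nat.card {X : Set V | IsFiber ℛ X} = n

/-- A scheme is reduced if no basis relation between distinct fibers is thin. -/
def IsReduced [Fintype V] (ℛ : Set (Set (V × V))) : Prop :=
  ∀ X Y : Set V, IsFiber ℛ X → IsFiber ℛ Y → X ≠ Y → ∀ R ∈ relsBtw ℛ X Y, ¬ IsThin R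

/-- A (possibly empty) union of fibers. -/
def IsFiberUnion [Fintype V] (ℛ : Set (Set (V × V))) (U : Set V) : Prop :=
  ∃ F : Set (Set V), (∀ X ∈ F, IsFiber ℛ X) ∧ U = ⋃₀ F

/-- The adjacency matrix of a relation. -/
noncomputable def adjMat [Fintype V] (R : Set (V × V)) : Matrix V V ℂ :=
  fun u v => if (u, v) ∈ R then 1 else 0

/-- The diagonal idempotent `I_X` of a subset `X ⊆ V`. -/
noncomputable def idMat [Fintype V] (X : Set V) : Matrix V V ℂ :=
  fun u v => if u = v ∧ u ∈ X then 1 else 0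

/-- The adjacency algebra `𝒜(𝒞)`, the subalgebra of `Mat_V(ℂ)` spanned by the
adjacency matrices of the basis relations. -/
noncomputable def adjAlg [Fintype V] [DecidableEq V] (ℛ : Set (Set (V × V))) :
    Subalgebra ℂ (Matrix V V ℂ) :=
  Algebra.adjoin ℂ (adjMat '' ℛ)

/-- `P` is a central primitive idempotent of the (multiplicatively closed) set of
matrices `S`: `P ∈ S` is a nonzero idempotent commuting with everything in `S`, which is
not the sum of two nonzero orthogonal central idempotents of `S`. -/
def IsCPIin [Fintype V] (S : Set (Matrix V V ℂ)) (P : Matrix V V ℂ) : Prop :=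
  P ∈ S ∧ P ≠ 0 ∧ P * P = P ∧ (∀ Q ∈ S, P * Q = Q * P) ∧
  ∀ Q₁ Q₂ : Matrix V V ℂ, Q₁ ∈ S → Q₂ ∈ S →
    Q₁ * Q₁ = Q₁ → Q₂ * Q₂ = Q₂ →
    (∀ M ∈ S, Q₁ * M = M * Q₁) → (∀ M ∈ S, Q₂ * M = M * Q₂) →
    Q₁ * Q₂ = 0 → Q₂ * Q₁ = 0 → P = Q₁ + Q₂ → Q₁ = 0 ∨ Q₂ = 0

/-- `𝒫(𝒞)`: the set of central primitive idempotents of the adjacency algebra. -/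
def CPIs [Fintype V] [DecidableEq V] (ℛ : Set (Set (V × V))) : Set (Matrix V V ℂ) :=
  {P | IsCPIin (adjAlg ℛ : Set (Matrix V V ℂ)) P}

/-- The adjacency algebra `I_X · 𝒜(𝒞) · I_X` of the homogeneous component `𝒞_X`,
as a subset of `Mat_V(ℂ)`. -/
def compAlgSet [Fintype V] [DecidableEq V] (ℛ : Set (Set (V × V))) (X : Set V) :
    Set (Matrix V V ℂ) :=
  {M | ∃ N ∈ adjAlg ℛ, M = idMat X * N * idMat X}

/-- `𝒫(𝒞_X)`: the central primitive idempotents of the homogeneous component `𝒞_X`. -/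
def CPIsComp [Fintype V] [DecidableEq V] (ℛ : Set (Set (V × V))) (X : Set V) :
    Set (Matrix V V ℂ) :=
  {P | IsCPIin (compAlgSet ℛ X) P}

/-- The degree `n_P` of a central primitive idempotent `P` of the algebra (given as the
set `S`): the positive integer with `n_P ^ 2 = dim_ℂ (S · P)`. -/
noncomputable def degOf [Fintype V] [DecidableEq V] (S : Set (Matrix V V ℂ))
    (P : Matrix V V ℂ) : ℕ :=
  Nat.sqrt (Module.finrank ℂ
    (Submodule.span ℂ {M : Matrix V V ℂ | ∃ a ∈ S, M = a * P}))


/-- The block algebra. -/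
abbrev Blk {n : ℕ} (d : Fin n → ℕ) := (i : Fin n) → Matrix (Fin (d i)) (Fin (d i)) ℂ

/-- Two-sided multiplication. -/
noncomputable def sandw {n : ℕ} {d : Fin n → ℕ} (p q : Blk d) : Blk d →ₗ[ℂ] Blk d :=
  (LinearMap.mulLeft ℂ p).comp (LinearMap.mulRight ℂ q)

lemma sandw_apply {n : ℕ} {d : Fin n → ℕ} (p q b : Blk d) : sandw p q b = p * b * q := by
  simp [sandw, mul_assoc]

lemma sandw_trace {n : ℕ} {d : Fin n → ℕ} (p q : Blk d) :
    LinearMap.trace ℂ (Blk d) (sandw p q) = ∑ i, (p i).trace * (q i).trace := by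
  rw [LinearMap.trace_eq_matrix_trace ℂ
    (Pi.basis (fun i => Matrix.stdBasis ℂ (Fin (d i)) (Fin (d i))))]
  rw [Matrix.trace, Fintype.sum_sigma]
  refine Finset.sum_congr rfl fun i _ => ?_
  rw [Fintype.sum_prod_type, Matrix.trace, Matrix.trace, Finset.sum_mul_sum]
  refine Finset.sum_congr rfl fun a _ => Finset.sum_congr rfl fun b _ => ?_
  rw [Matrix.diag_apply, LinearMap.toMatrix_apply, Pi.basis_repr, Pi.basis_apply, sandw_apply]
  simp only [Matrix.stdBasis_eq_single, Pi.mul_apply, Pi.single_eq_same]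
  have : ∀ M : Matrix (Fin (d i)) (Fin (d i)) ℂ, (Matrix.stdBasis ℂ _ _).repr M (a, b) = M a b := by
    intro M
    simp [Matrix.stdBasis]
  rw [this]
  simp [Matrix.mul_apply, Matrix.single_apply, ite_and]

lemma finrank_sandw {n : ℕ} {d : Fin n → ℕ} (p q : Blk d) (hp : p * p = p) (hq : q * q = q) :
    (Module.finrank ℂ (LinearMap.range (sandw p q)) : ℂ) = ∑ i, (p i).trace * (q i).trace := by
  rw [← sandw_trace]
  have h : IsIdempotentElem (sandw p q) := by
    apply LinearMap.ext
    intro b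
    rw [Module.End.mul_apply]
    simp only [sandw_apply]
    rw [show p * (p * b * q) * q = (p * p) * b * (q * q) by simp only [mul_assoc], hp, hq]
  exact (LinearMap.IsProj.trace (LinearMap.IsIdempotentElem.isProj_range _ h)).symm

lemma trace_idem {m : ℕ} (p : Matrix (Fin m) (Fin m) ℂ) (hp : p * p = p) :
    ∃ r : ℕ, p.trace = r := by
  have h : IsIdempotentElem (Matrix.toLin' p) := by
    unfold IsIdempotentElem
    rw [Module.End.mul_eq_comp, ← Matrix.toLin'_mul, hp]
  refine ⟨Module.finrank ℂ (LinearMap.range (Matrix.toLin' p)), ?_⟩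
  rw [← LinearMap.IsProj.trace (LinearMap.IsIdempotentElem.isProj_range _ h)]
  simp

lemma central_scalar {m : ℕ} (p z : Matrix (Fin m) (Fin m) ℂ)
    (h1 : p * z = z) (h2 : z * p = z)
    (hz : ∀ E, z * (p * E * p) = (p * E * p) * z) : ∃ c : ℂ, z = c • p := by
  by_cases hp : p = 0
  · exact ⟨0, by rw [← h1, hp]; simp⟩
  obtain ⟨b, j, hbj⟩ : ∃ b j, p b j ≠ 0 := by
    by_contra! h
    exact hp (Matrix.ext h)
  refine ⟨z b j / p b j, ?_⟩
  ext i a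
  have := hz (Matrix.single a b 1)
  rw [mul_assoc, ← mul_assoc z, h2, mul_assoc, mul_assoc _ p z, h1, ← mul_assoc, ← mul_assoc] at this
  have := congrFun (congrFun this i) j
  simp [Matrix.mul_apply, Matrix.single_apply, ite_and] at this
  rw [Matrix.smul_apply, smul_eq_mul]
  field_simp
  linear_combination this

lemma single_mul_blk {n : ℕ} {d : Fin n → ℕ} (i : Fin n) (x) (b : Blk d) :
    (Pi.single i x : Blk d) * b = Pi.single i (x * b i) := by
  ext j : 1
  by_cases h : j = i
  · subst h; simp
  · simp [h]

lemma mul_single_blk {n : ℕ} {d : Fin n → ℕ} (i : Fin n) (x) (b : Blk d) :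
    b * (Pi.single i x : Blk d) = Pi.single i (b i * x) := by
  ext j : 1
  by_cases h : j = i
  · subst h; simp
  · simp [h]

lemma central_blk {n : ℕ} {d : Fin n → ℕ} (p z : Blk d) (hp : p * p = p)
    (h1 : p * z = z) (h2 : z * p = z)
    (hz : ∀ E, z * (p * E * p) = (p * E * p) * z) (j : Fin n) : ∃ c : ℂ, z j = c • p j := by
  apply central_scalar
  · exact congrFun h1 j
  · exact congrFun h2 j
  · intro E
    have := congrFun (hz (Pi.single j E)) j
    simpa using this

lemma isCPI_iff [Fintype V] [DecidableEq V] {n : ℕ} {d : Fin n → ℕ}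
    (ψ : Blk d →ₐ[ℂ] Matrix V V ℂ) (hψ : Function.Injective ψ) (p : Blk d) (hp : p * p = p)
    (S : Set (Matrix V V ℂ)) (hS : ∀ M, M ∈ S ↔ ∃ b, M = ψ (p * b * p)) (M : Matrix V V ℂ) :
    IsCPIin S M ↔ ∃ i, p i ≠ 0 ∧ M = ψ (Pi.single i (p i)) := by
  have hpi : ∀ i, p i * p i = p i := fun i => congrFun hp i
  have key : ∀ Q ∈ S, (∀ M ∈ S, Q * M = M * Q) → ∃ z, Q = ψ z ∧ p * z = z ∧ z * p = z ∧
      ∀ j, ∃ c : ℂ, z j = c • p j := by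
    intro Q hQ hc
    obtain ⟨b, rfl⟩ := (hS _).1 hQ
    have h1 : p * (p * b * p) = p * b * p := by
      rw [← mul_assoc, ← mul_assoc, hp]
    have h2 : (p * b * p) * p = p * b * p := by
      rw [mul_assoc, hp]
    refine ⟨_, rfl, h1, h2, ?_⟩
    apply central_blk _ _ hp h1 h2
    intro E
    apply hψ
    rw [map_mul, map_mul ψ (p * E * p)]
    exact hc _ ((hS _).2 ⟨_, rfl⟩)
  have cen : ∀ i (c : ℂ), ψ (Pi.single i (c • p i)) ∈ S ∧
      ∀ M ∈ S, ψ (Pi.single i (c • p i)) * M = M * ψ (Pi.single i (c • p i)) := by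
    intro i c
    constructor
    · refine (hS _).2 ⟨Pi.single i (c • 1), ?_⟩
      rw [mul_single_blk, single_mul_blk]
      simp [hpi]
    · intro M hM
      obtain ⟨b, rfl⟩ := (hS _).1 hM
      rw [← map_mul, ← map_mul, single_mul_blk, mul_single_blk]
      congr 2
      simp only [Pi.mul_apply, smul_mul_assoc, mul_smul_comm]
      rw [mul_assoc _ (p i) (p i), hpi, ← mul_assoc, ← mul_assoc, hpi]
  have sadd : ∀ A ∈ S, ∀ B ∈ S, A - B ∈ S := by
    intro A hA B hB
    obtain ⟨a, rfl⟩ := (hS _).1 hA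
    obtain ⟨b, rfl⟩ := (hS _).1 hB
    refine (hS _).2 ⟨a - b, ?_⟩
    rw [← map_sub, mul_sub, sub_mul]
  constructor
  · rintro ⟨hMS, hM0, hMM, hMc, hprim⟩
    obtain ⟨z, rfl, h1, h2, hsc⟩ := key M hMS hMc
    have hzz : z * z = z := hψ (by rw [map_mul, hMM])
    have hz0 : z ≠ 0 := by rintro rfl; exact hM0 (map_zero _)
    obtain ⟨i, hi⟩ : ∃ i, z i ≠ 0 := by
      by_contra! h
      exact hz0 (funext h)
    obtain ⟨c, hc⟩ := hsc i
    have hzzi : z i * z i = z i := congrFun hzz i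
    have hp0 : p i ≠ 0 := by
      intro h; rw [h, smul_zero] at hc; exact hi hc
    have hc0 : c ≠ 0 := by
      intro h; rw [h, zero_smul] at hc; exact hi hc
    have hc1 : c = 1 := by
      rw [hc, smul_mul_smul_comm, hpi] at hzzi
      have := smul_left_injective ℂ hp0 hzzi
      exact mul_right_cancel₀ hc0 (by rw [one_mul]; exact this)
    rw [hc1, one_smul] at hc
    refine ⟨i, hp0, ?_⟩
    obtain ⟨cS, cC⟩ := cen i 1
    rw [one_smul] at cS cC
    have e1 : (Pi.single i (p i) : Blk d) * Pi.single i (p i) = Pi.single i (p i) := by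
      rw [single_mul_blk]; simp [hpi]
    have e2 : (Pi.single i (p i) : Blk d) * z = Pi.single i (p i) := by
      rw [single_mul_blk, hc, hpi]
    have e3 : z * (Pi.single i (p i) : Blk d) = Pi.single i (p i) := by
      rw [mul_single_blk, hc, hpi]
    have := hprim (ψ (Pi.single i (p i))) (ψ z - ψ (Pi.single i (p i))) cS (sadd _ hMS _ cS)
      (by rw [← map_mul, e1]) (by
        rw [← map_sub, ← map_mul, sub_mul, mul_sub, mul_sub, hzz, e1, e2, e3]; simp)
      cC (by intro M hM; rw [sub_mul, mul_sub, cC M hM, hMc M hM])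
      (by rw [← map_sub, ← map_mul, mul_sub, e1, e2]; simp)
      (by rw [← map_sub, ← map_mul, sub_mul, e1, e3]; simp)
      (by abel)
    rcases this with h | h
    · exfalso
      have : (Pi.single i (p i) : Blk d) = 0 := hψ (by rw [h, map_zero])
      have := congrFun this i
      simp at this
      exact hp0 this
    · exact sub_eq_zero.1 h
  · rintro ⟨i, hi, rfl⟩
    obtain ⟨cS, cC⟩ := cen i 1
    rw [one_smul] at cS cC
    refine ⟨cS, ?_, ?_, cC, ?_⟩
    · intro h
      have : (Pi.single i (p i) : Blk d) = 0 := hψ (by rw [h, map_zero])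
      have := congrFun this i
      simp at this
      exact hi this
    · rw [← map_mul, single_mul_blk]; simp [hpi]
    · intro Q₁ Q₂ hQ₁ hQ₂ i₁ i₂ c₁ c₂ o12 o21 hsum
      obtain ⟨z, rfl, -, -, hsc⟩ := key Q₁ hQ₁ c₁
      obtain ⟨w, rfl, -, -, hsc'⟩ := key Q₂ hQ₂ c₂
      have hzz : z * z = z := hψ (by rw [map_mul, i₁])
      have hww : w * w = w := hψ (by rw [map_mul, i₂])
      have hzw : z * w = 0 := hψ (by rw [map_mul, o12, map_zero])
      have hs : Pi.single i (p i) = z + w := hψ (by rw [hsum, map_add])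
      have hoff : ∀ j, j ≠ i → z j = 0 ∧ w j = 0 := by
        intro j hj
        have hs' := congrFun hs j
        simp [hj] at hs'
        have a1 : z j * z j = z j := congrFun hzz j
        have a2 : z j * w j = 0 := congrFun hzw j
        have : z j = 0 := by
          calc z j = z j * (z j + w j) := by rw [mul_add, a1, a2, add_zero]
            _ = 0 := by rw [← hs', mul_zero]
        refine ⟨this, ?_⟩
        rw [this, zero_add] at hs'
        exact hs'.symm
      obtain ⟨c, hc⟩ := hsc i
      obtain ⟨c', hc'⟩ := hsc' i
      have a2 : z i * w i = 0 := congrFun hzw i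
      rw [hc, hc', smul_mul_smul_comm, hpi, smul_eq_zero] at a2
      have : c = 0 ∨ c' = 0 := by
        rcases a2 with h | h
        · exact mul_eq_zero.1 h
        · exact absurd h hi
      rcases this with h | h
      · left
        have : z = 0 := by
          funext j
          by_cases hj : j = i
          · subst hj; rw [hc, h, zero_smul]; rfl
          · exact (hoff j hj).1
        rw [this, map_zero]
      · right
        have : w = 0 := by
          funext j
          by_cases hj : j = i
          · subst hj; rw [hc', h, zero_smul]; rfl
          · exact (hoff j hj).2
        rw [this, map_zero]

open scoped ComplexOrder in
lemma herm_nilp [Fintype V] [DecidableEq V] (h : Matrix V V ℂ) (hh : h.conjTranspose = h) (k : ℕ) :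
    h ^ (2 ^ k) = 0 → h = 0 := by
  induction k with
  | zero => intro h0; simpa using h0
  | succ k ih =>
    intro h0
    apply ih
    rw [pow_succ, mul_two, pow_add] at h0
    rw [← Matrix.conjTranspose_mul_self_eq_zero, Matrix.conjTranspose_pow, hh, h0]

open scoped ComplexOrder in
lemma semisimple_of_star [Fintype V] [DecidableEq V] (A : Subalgebra ℂ (Matrix V V ℂ))
    (hA : ∀ M ∈ A, M.conjTranspose ∈ A) : IsSemisimpleRing A := by
  have : IsArtinianRing A := IsArtinianRing.of_finite ℂ A
  rw [IsArtinianRing.isSemisimpleRing_iff_jacobson]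
  have hn : IsNilpotent (Ring.jacobson A) := by
    have := IsArtinianRing.isNilpotent_jacobson_bot (R := A)
    rwa [Ideal.jacobson_bot] at this
  obtain ⟨n, hn⟩ := hn
  rw [eq_bot_iff]
  intro a ha
  let s : A := ⟨(a : Matrix V V ℂ).conjTranspose, hA _ a.2⟩
  have hs : s * a ∈ Ring.jacobson A := Ideal.mul_mem_left _ _ ha
  have hp : (s * a) ^ n = 0 := by
    have := Ideal.pow_mem_pow hs n
    rw [hn] at this
    simpa using this
  have h2 : (s * a) ^ (2 ^ n) = 0 := by
    have : n ≤ 2 ^ n := Nat.lt_two_pow_self.le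
    exact pow_eq_zero_of_le this hp
  have h3 : ((a : Matrix V V ℂ).conjTranspose * (a : Matrix V V ℂ)) ^ (2 ^ n) = 0 := by
    have := congrArg (Subtype.val) h2
    simpa [s] using this
  have h4 := herm_nilp _ (by simp) n h3
  rw [Matrix.conjTranspose_mul_self_eq_zero] at h4
  rw [Submodule.mem_bot]
  exact Subtype.ext h4

lemma exists_blk [Fintype V] [DecidableEq V] (A : Subalgebra ℂ (Matrix V V ℂ))
    (hA : ∀ M ∈ A, M.conjTranspose ∈ A) :
    ∃ (n : ℕ) (d : Fin n → ℕ) (ψ : Blk d →ₐ[ℂ] Matrix V V ℂ), (∀ i, d i ≠ 0) ∧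
      Function.Injective ψ ∧ ∀ M, M ∈ A ↔ ∃ b, ψ b = M := by
  have := semisimple_of_star A hA
  obtain ⟨n, d, hd, ⟨e⟩⟩ := IsSemisimpleRing.exists_algEquiv_pi_matrix_of_isAlgClosed ℂ A
  refine ⟨n, d, A.val.comp e.symm.toAlgHom, fun i => (hd i).out, ?_, ?_⟩
  · exact Subtype.val_injective.comp e.symm.injective
  · intro M
    constructor
    · intro hM
      exact ⟨e ⟨M, hM⟩, by simp⟩
    · rintro ⟨b, rfl⟩
      exact (e.symm b).2

/-- Matrices constant on basis relations. -/
def ConstOn (ℛ : Set (Set (V × V))) (M : Matrix V V ℂ) : Prop :=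
  ∀ R ∈ ℛ, ∀ p ∈ R, ∀ q ∈ R, M p.1 p.2 = M q.1 q.2

section CC
variable [Fintype V] [DecidableEq V] {ℛ : Set (Set (V × V))}

lemma rel_eq (h : IsCC ℛ) {R S : Set (V × V)} (hR : R ∈ ℛ) (hS : S ∈ ℛ) {p} (pR : p ∈ R)
    (pS : p ∈ S) : R = S :=
  (h.2.1 p).unique ⟨hR, pR⟩ ⟨hS, pS⟩

lemma adjMat_const (h : IsCC ℛ) {R : Set (V × V)} (hR : R ∈ ℛ) : ConstOn ℛ (adjMat R) := by
  intro S hS p hp q hq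
  simp only [adjMat]
  by_cases hRS : R = S
  · subst hRS; simp [hp, hq]
  · rw [if_neg, if_neg]
    · intro hh; exact hRS (rel_eq h hR hS hh hq)
    · intro hh; exact hRS (rel_eq h hR hS hh hp)

lemma adjMat_mul (R S : Set (V × V)) (u v : V) :
    (adjMat R * adjMat S) u v = (iNum R S (u, v) : ℂ) := by
  simp only [Matrix.mul_apply, adjMat, iNum]
  rw [Nat.card_eq_fintype_card, Fintype.card_subtype]
  simp [← ite_and, Finset.sum_boole, and_comm]

lemma constOn_eq_sum (h : IsCC ℛ) {M : Matrix V V ℂ} (hM : ConstOn ℛ M) :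
    ∃ f : Set (V × V) → ℂ, (∀ R ∈ ℛ, ∀ p ∈ R, f R = M p.1 p.2) ∧
      M = ∑ R : ℛ, f R • adjMat (R : Set (V × V)) := by
  refine ⟨fun R => if hR : R.Nonempty then M hR.choose.1 hR.choose.2 else 0, ?_, ?_⟩
  · intro R hR p hp
    have hn : R.Nonempty := ⟨p, hp⟩
    simp only [dif_pos hn]
    exact hM R hR _ hn.choose_spec _ hp
  · ext u v
    obtain ⟨R, ⟨hR, hp⟩, -⟩ := h.2.1 (u, v)
    rw [Matrix.sum_apply, Finset.sum_eq_single (⟨R, hR⟩ : ℛ)]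
    · have hn : R.Nonempty := ⟨_, hp⟩
      simp only [Matrix.smul_apply, adjMat, if_pos hp, dif_pos hn, smul_eq_mul, mul_one]
      exact hM R hR _ hp _ hn.choose_spec
    · intro S _ hS
      simp only [Matrix.smul_apply, adjMat]
      rw [if_neg, smul_zero]
      intro hh
      exact hS (Subtype.ext (rel_eq h S.2 hR hh hp))
    · simp

lemma constOn_mul (h : IsCC ℛ) {M N : Matrix V V ℂ} (hM : ConstOn ℛ M) (hN : ConstOn ℛ N) :
    ConstOn ℛ (M * N) := by
  obtain ⟨f, -, rfl⟩ := constOn_eq_sum h hM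
  obtain ⟨g, -, rfl⟩ := constOn_eq_sum h hN
  intro T hT p hp q hq
  rw [Finset.sum_mul_sum]
  simp only [Matrix.sum_apply]
  refine Finset.sum_congr rfl fun R _ => Finset.sum_congr rfl fun S _ => ?_
  rw [smul_mul_smul_comm, Matrix.smul_apply, Matrix.smul_apply, adjMat_mul, adjMat_mul]
  rw [h.2.2.2.2 R R.2 S S.2 T hT p hp q hq]

/-- The algebra of matrices constant on basis relations. -/
def constAlg (h : IsCC ℛ) : Subalgebra ℂ (Matrix V V ℂ) where
  carrier := {M | ConstOn ℛ M}
  mul_mem' := fun hM hN => constOn_mul h hM hN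
  add_mem' := by
    intro M N hM hN R hR p hp q hq
    rw [Matrix.add_apply, Matrix.add_apply, hM R hR p hp q hq, hN R hR p hp q hq]
  algebraMap_mem' := by
    intro c R hR p hp q hq
    rw [Matrix.algebraMap_matrix_apply, Matrix.algebraMap_matrix_apply]
    have h1 := h.2.2.1 R hR
    by_cases hpe : p.1 = p.2
    · rw [if_pos hpe, if_pos (h1 ⟨p, hp, hpe⟩ q hq)]
    · rw [if_neg hpe, if_neg (fun hq' => hpe (h1 ⟨q, hq, hq'⟩ p hp))]

lemma mem_adjAlg (h : IsCC ℛ) (M : Matrix V V ℂ) : M ∈ adjAlg ℛ ↔ ConstOn ℛ M := by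
  constructor
  · have : adjAlg ℛ ≤ constAlg h := by
      apply Algebra.adjoin_le
      rintro _ ⟨R, hR, rfl⟩
      exact adjMat_const h hR
    exact fun hM => this hM
  · intro hM
    obtain ⟨f, -, rfl⟩ := constOn_eq_sum h hM
    refine Subalgebra.sum_mem _ fun R _ => Subalgebra.smul_mem _ ?_ _
    exact Algebra.subset_adjoin ⟨R, R.2, rfl⟩

lemma adjAlg_star (h : IsCC ℛ) (M : Matrix V V ℂ) (hM : M ∈ adjAlg ℛ) :
    M.conjTranspose ∈ adjAlg ℛ := by
  rw [mem_adjAlg h] at *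
  intro R hR p hp q hq
  rw [Matrix.conjTranspose_apply, Matrix.conjTranspose_apply]
  congr 1
  exact hM _ (h.2.2.2.1 R hR) p.swap hp q.swap hq

lemma idMat_mem (h : IsCC ℛ) {X : Set V} (hX : IsFiber ℛ X) : idMat X ∈ adjAlg ℛ := by
  have : idMat X = adjMat (diag X) := by
    ext u v
    simp only [idMat, adjMat, diag, Set.mem_ofPred_eq]
    congr 1
    exact propext and_comm
  rw [this]
  exact Algebra.subset_adjoin ⟨_, hX.2, rfl⟩

lemma idMat_mul_apply (X : Set V) (M : Matrix V V ℂ) (u v : V) :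
    (idMat X * M) u v = if u ∈ X then M u v else 0 := by
  simp [Matrix.mul_apply, idMat, ite_and]

lemma mul_idMat_apply (X : Set V) (M : Matrix V V ℂ) (u v : V) :
    (M * idMat X) u v = if v ∈ X then M u v else 0 := by
  simp [Matrix.mul_apply, idMat, ite_and]

lemma idMat_idem (X : Set V) : idMat X * idMat X = idMat X := by
  ext u v
  rw [idMat_mul_apply]
  simp only [idMat]
  split_ifs <;> tauto

lemma exists_fiber (h : IsCC ℛ) (v : V) : ∃ X, IsFiber ℛ X ∧ v ∈ X := by
  obtain ⟨R, ⟨hR, hp⟩, -⟩ := h.2.1 (v, v)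
  have hd := h.2.2.1 R hR ⟨_, hp, rfl⟩
  have : diag {x | (x, x) ∈ R} = R := by
    ext ⟨a, b⟩
    simp only [diag, Set.mem_ofPred_eq]
    constructor
    · rintro ⟨h1, rfl⟩; exact h1
    · intro hab
      have : a = b := hd _ hab
      subst this
      exact ⟨hab, rfl⟩
  exact ⟨{x | (x, x) ∈ R}, ⟨⟨v, hp⟩, by rw [this]; exact hR⟩, hp⟩

lemma fiber_eq (h : IsCC ℛ) {X Y : Set V} (hX : IsFiber ℛ X) (hY : IsFiber ℛ Y) {v : V}
    (vX : v ∈ X) (vY : v ∈ Y) : X = Y := by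
  have := rel_eq h hX.2 hY.2 (p := (v, v)) ⟨vX, rfl⟩ ⟨vY, rfl⟩
  ext x
  have := Set.ext_iff.1 this (x, x)
  simpa [diag] using this

lemma sum_idMat (h : IsCC ℛ) : ∑ X : {X : Set V | IsFiber ℛ X}, idMat (X : Set V) = 1 := by
  ext u v
  obtain ⟨X, hX, hu⟩ := exists_fiber h u
  rw [Matrix.sum_apply, Finset.sum_eq_single (⟨X, hX⟩ : {X : Set V | IsFiber ℛ X})]
  · simp [idMat, hu, Matrix.one_apply]
  · intro Y _ hY
    simp only [idMat]
    rw [if_neg]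
    rintro ⟨-, hh⟩
    exact hY (Subtype.ext (fiber_eq h Y.2 hX hh hu))
  · simp

lemma rel_sub (h : IsCC ℛ) {X Y : Set V} (hX : IsFiber ℛ X) (hY : IsFiber ℛ Y)
    {R : Set (V × V)} (hR : R ∈ ℛ) {p : V × V} (hp : p ∈ R) (p1 : p.1 ∈ X) (p2 : p.2 ∈ Y) :
    R ⊆ X ×ˢ Y := by
  have hm : idMat X * adjMat R * idMat Y ∈ adjAlg ℛ :=
    mul_mem (mul_mem (idMat_mem h hX) (Algebra.subset_adjoin ⟨R, hR, rfl⟩)) (idMat_mem h hY)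
  rw [mem_adjAlg h] at hm
  intro q hq
  have := hm R hR p hp q hq
  rw [mul_idMat_apply, mul_idMat_apply, idMat_mul_apply, idMat_mul_apply, if_pos p1, if_pos p2] at this
  simp only [adjMat, Prod.mk.eta, if_pos hp, if_pos hq] at this
  by_contra hcon
  rw [Set.mem_prod] at hcon
  by_cases h2 : q.2 ∈ Y
  · have h1 : q.1 ∉ X := fun h1 => hcon ⟨h1, h2⟩
    simp [h1] at this
  · simp [h2] at this

/-- Linear combinations of the adjacency matrices in `ℛ_{X,Y}`. -/
noncomputable def comb (ℛ : Set (Set (V × V))) (X Y : Set V) :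
    (relsBtw ℛ X Y → ℂ) →ₗ[ℂ] Matrix V V ℂ :=
  Fintype.linearCombination ℂ (fun R : relsBtw ℛ X Y => adjMat (R : Set (V × V)))

lemma comb_apply_mem (h : IsCC ℛ) {X Y : Set V} (f : relsBtw ℛ X Y → ℂ) (R : relsBtw ℛ X Y)
    (p : V × V) (hp : p ∈ (R : Set (V × V))) : comb ℛ X Y f p.1 p.2 = f R := by
  rw [comb, Fintype.linearCombination_apply, Matrix.sum_apply, Finset.sum_eq_single R]
  · simp [adjMat, hp]
  · intro S _ hS
    simp only [Matrix.smul_apply, adjMat]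
    rw [if_neg, smul_zero]
    intro hh
    exact hS (Subtype.ext (rel_eq h S.2.1 R.2.1 hh hp))
  · simp

lemma comb_apply_not_mem {X Y : Set V} (f : relsBtw ℛ X Y → ℂ)
    (p : V × V) (hp : ¬ (p.1 ∈ X ∧ p.2 ∈ Y)) : comb ℛ X Y f p.1 p.2 = 0 := by
  rw [comb, Fintype.linearCombination_apply, Matrix.sum_apply]
  apply Finset.sum_eq_zero
  intro S _
  simp only [Matrix.smul_apply, adjMat]
  rw [if_neg, smul_zero]
  intro hh
  exact hp (S.2.2 hh)

lemma finrank_comb (h : IsCC ℛ) (X Y : Set V) :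
    Module.finrank ℂ (LinearMap.range (comb ℛ X Y)) = Nat.card (relsBtw ℛ X Y) := by
  rw [LinearMap.finrank_range_of_inj, Module.finrank_fintype_fun_eq_card, Nat.card_eq_fintype_card]
  intro f g hfg
  funext R
  obtain ⟨p, hp⟩ := h.1 R R.2.1
  rw [← comb_apply_mem h f R p hp, ← comb_apply_mem h g R p hp, hfg]

lemma range_comb (h : IsCC ℛ) {X Y : Set V} (hX : IsFiber ℛ X) (hY : IsFiber ℛ Y)
    (M : Matrix V V ℂ) :
    M ∈ LinearMap.range (comb ℛ X Y) ↔ ∃ N ∈ adjAlg ℛ, M = idMat X * N * idMat Y := by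
  constructor
  · rintro ⟨f, rfl⟩
    refine ⟨comb ℛ X Y f, ?_, ?_⟩
    · rw [comb, Fintype.linearCombination_apply]
      refine Subalgebra.sum_mem _ fun R _ => Subalgebra.smul_mem _ ?_ _
      exact Algebra.subset_adjoin ⟨R, R.2.1, rfl⟩
    · ext u v
      rw [mul_idMat_apply, idMat_mul_apply]
      by_cases hh : u ∈ X ∧ v ∈ Y
      · rw [if_pos hh.1, if_pos hh.2]
      · rw [comb_apply_not_mem f (u, v) hh]
        simp
  · rintro ⟨N, hN, rfl⟩
    rw [mem_adjAlg h] at hN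
    obtain ⟨f, hf, -⟩ := constOn_eq_sum h hN
    refine ⟨fun R => f R, ?_⟩
    ext u v
    rw [mul_idMat_apply, idMat_mul_apply]
    by_cases hh : u ∈ X ∧ v ∈ Y
    · rw [if_pos hh.1, if_pos hh.2]
      obtain ⟨R, ⟨hR, hp⟩, -⟩ := h.2.1 (u, v)
      rw [comb_apply_mem h _ ⟨R, hR, rel_sub h hX hY hR hp hh.1 hh.2⟩ (u, v) hp]
      exact hf R hR (u, v) hp
    · rw [comb_apply_not_mem _ (u, v) hh]
      by_cases hv : v ∈ Y
      · have hu : u ∉ X := fun hu => hh ⟨hu, hv⟩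
        simp [hu]
      · simp [hv]

end CC

lemma span_range [Fintype V] [DecidableEq V] {n : ℕ} {d : Fin n → ℕ}
    (ψ : Blk d →ₐ[ℂ] Matrix V V ℂ) (hψ : Function.Injective ψ) (p q : Blk d)
    (hp : p * p = p) (hq : q * q = q) (W : Submodule ℂ (Matrix V V ℂ))
    (hS : ∀ M, M ∈ W ↔ ∃ b, M = ψ (p * b * q)) :
    (Module.finrank ℂ W : ℂ) = ∑ i, (p i).trace * (q i).trace := by
  have : W = (LinearMap.range (sandw p q)).map ψ.toLinearMap := by
    ext M
    rw [hS, Submodule.mem_map]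
    constructor
    · rintro ⟨b, rfl⟩
      exact ⟨_, ⟨b, rfl⟩, by rw [sandw_apply]; rfl⟩
    · rintro ⟨_, ⟨b, rfl⟩, rfl⟩
      exact ⟨b, by rw [sandw_apply]; rfl⟩
  rw [this, ← (Submodule.equivMapOfInjective ψ.toLinearMap hψ _).finrank_eq, finrank_sandw p q hp hq]

lemma degOf_eq [Fintype V] [DecidableEq V] {n : ℕ} {d : Fin n → ℕ}
    (ψ : Blk d →ₐ[ℂ] Matrix V V ℂ) (hψ : Function.Injective ψ) (p : Blk d)
    (hp : p * p = p) (S : Set (Matrix V V ℂ)) (hS : ∀ M, M ∈ S ↔ ∃ b, M = ψ (p * b * p))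
    (i : Fin n) (r : ℕ) (hr : (p i).trace = r) :
    degOf S (ψ (Pi.single i (p i))) = r := by
  have hpi : ∀ i, p i * p i = p i := fun i => congrFun hp i
  have hset : {M : Matrix V V ℂ | ∃ a ∈ S, M = a * ψ (Pi.single i (p i))} =
      ((LinearMap.range (sandw p (Pi.single i (p i)))).map ψ.toLinearMap :
        Submodule ℂ (Matrix V V ℂ)) := by
    ext M
    rw [SetLike.mem_coe, Submodule.mem_map]
    constructor
    · rintro ⟨a, ha, rfl⟩
      obtain ⟨b, rfl⟩ := (hS _).1 ha
      refine ⟨_, ⟨b, rfl⟩, ?_⟩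
      rw [sandw_apply, ← map_mul, mul_assoc _ p, mul_single_blk i _ p, hpi]; rfl
    · rintro ⟨_, ⟨b, rfl⟩, rfl⟩
      refine ⟨_, (hS _).2 ⟨b, rfl⟩, ?_⟩
      rw [sandw_apply, ← map_mul, mul_assoc _ p, mul_single_blk i _ p, hpi]; rfl
  have hfr : Module.finrank ℂ (Submodule.span ℂ
      {M : Matrix V V ℂ | ∃ a ∈ S, M = a * ψ (Pi.single i (p i))}) = r * r := by
    rw [hset, Submodule.span_eq]
    have := span_range ψ hψ p (Pi.single i (p i)) hp (by rw [single_mul_blk]; simp [hpi])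
      ((LinearMap.range (sandw p (Pi.single i (p i)))).map ψ.toLinearMap) (by
        intro M
        rw [Submodule.mem_map]
        constructor
        · rintro ⟨_, ⟨b, rfl⟩, rfl⟩
          exact ⟨b, by rw [sandw_apply]; rfl⟩
        · rintro ⟨b, rfl⟩
          exact ⟨_, ⟨b, rfl⟩, by rw [sandw_apply]; rfl⟩)
    rw [Finset.sum_eq_single i] at this
    · rw [Pi.single_eq_same, hr] at this
      exact_mod_cast this
    · intro j _ hj
      simp [hj]
    · simp
  rw [degOf, hfr, Nat.sqrt_eq]

/-- **Theorem (Statement 0).** A coherent configuration `𝒞` is balanced if and only if for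
each fiber `X` the map `P ↦ P·I_X` is a well-defined bijection from `𝒫(𝒞)` onto `𝒫(𝒞_X)`,
and `n_P = |Fib(𝒞)| · n_{P_X}` for every `P ∈ 𝒫(𝒞)`. -/
theorem balanced_iff_CPI_restriction_bijective
    {V : Type*} [Fintype V] [DecidableEq V] [Nonempty V]
    (ℛ : Set (Set (V × V))) (hCC : IsCC ℛ) :
    IsBalanced ℛ ↔
      ∀ X : Set V, IsFiber ℛ X →
        Set.BijOn (fun P : Matrix V V ℂ => P * idMat X) (CPIs ℛ) (CPIsComp ℛ X) ∧
        ∀ P ∈ CPIs ℛ,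
          degOf (adjAlg ℛ : Set (Matrix V V ℂ)) P =
            Nat.card {Y : Set V | IsFiber ℛ Y} * degOf (compAlgSet ℛ X) (P * idMat X) := by
  obtain ⟨n, d, ψ, hd, hψ, hmem⟩ := exists_blk (adjAlg ℛ) (adjAlg_star hCC)
  have hex : ∀ X : {X : Set V | IsFiber ℛ X}, ∃ b : Blk d, ψ b = idMat (X : Set V) :=
    fun X => (hmem _).1 (idMat_mem hCC X.2)
  choose p hpψ using hex
  have pid : ∀ X, p X * p X = p X := fun X => hψ (by rw [map_mul, hpψ, idMat_idem])
  have psum : ∑ X, p X = 1 := hψ (by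
    rw [map_sum, map_one, ← sum_idMat hCC]
    exact Finset.sum_congr rfl fun X _ => hpψ X)
  have htr : ∀ X i, ∃ r : ℕ, (p X i).trace = r :=
    fun X i => trace_idem _ (congrFun (pid X) i)
  choose t ht using htr
  have hdim : ∀ X Y : {X : Set V | IsFiber ℛ X},
      Nat.card (relsBtw ℛ (X : Set V) (Y : Set V)) = ∑ i, t X i * t Y i := by
    intro X Y
    rw [← finrank_comb hCC]
    have := span_range ψ hψ (p X) (p Y) (pid X) (pid Y)
      (LinearMap.range (comb ℛ (X : Set V) (Y : Set V))) (by
        intro M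
        rw [range_comb hCC X.2 Y.2]
        constructor
        · rintro ⟨N, hN, rfl⟩
          obtain ⟨b, rfl⟩ := (hmem _).1 hN
          exact ⟨b, by rw [map_mul, map_mul, hpψ, hpψ]⟩
        · rintro ⟨b, rfl⟩
          exact ⟨ψ b, (hmem _).2 ⟨b, rfl⟩, by rw [map_mul, map_mul, hpψ, hpψ]⟩)
    simp only [ht] at this
    exact_mod_cast this
  have hdsum : ∀ i, ∑ X, t X i = d i := by
    intro i
    have h1 := congrArg Matrix.trace (congrFun psum i)
    rw [Finset.sum_apply, Matrix.trace_sum, Pi.one_apply, Matrix.trace_one, Fintype.card_fin] at h1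
    simp only [ht] at h1
    exact_mod_cast h1
  have one_ne : ∀ i, (1 : Blk d) i ≠ 0 := by
    intro i h
    have h1 := congrArg Matrix.trace h
    rw [Pi.one_apply, Matrix.trace_one, Fintype.card_fin, Matrix.trace_zero] at h1
    exact hd i (by exact_mod_cast h1)
  have cA : ∀ M, M ∈ (adjAlg ℛ : Set (Matrix V V ℂ)) ↔ ∃ b, M = ψ (1 * b * 1) := by
    intro M
    rw [SetLike.mem_coe, hmem]
    constructor
    · rintro ⟨b, rfl⟩; exact ⟨b, by simp⟩
    · rintro ⟨b, rfl⟩; exact ⟨b, by simp⟩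
  have cX : ∀ X : {X : Set V | IsFiber ℛ X}, ∀ M, M ∈ compAlgSet ℛ (X : Set V) ↔
      ∃ b, M = ψ (p X * b * p X) := by
    intro X M
    constructor
    · rintro ⟨N, hN, rfl⟩
      obtain ⟨b, rfl⟩ := (hmem _).1 hN
      exact ⟨b, by rw [map_mul, map_mul, hpψ]⟩
    · rintro ⟨b, rfl⟩
      exact ⟨ψ b, (hmem _).2 ⟨b, rfl⟩, by rw [map_mul, map_mul, hpψ]⟩
  have hP : ∀ P, P ∈ CPIs ℛ ↔ ∃ i, P = ψ (Pi.single i ((1 : Blk d) i)) := by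
    intro P
    refine (isCPI_iff ψ hψ 1 (one_mul 1) _ cA P).trans ?_
    exact ⟨fun ⟨i, _, h⟩ => ⟨i, h⟩, fun ⟨i, h⟩ => ⟨i, one_ne i, h⟩⟩
  have hPX : ∀ (X : {X : Set V | IsFiber ℛ X}) (P), P ∈ CPIsComp ℛ (X : Set V) ↔
      ∃ i, p X i ≠ 0 ∧ P = ψ (Pi.single i (p X i)) :=
    fun X P => isCPI_iff ψ hψ (p X) (pid X) _ (cX X) P
  have hmulX : ∀ (X : {X : Set V | IsFiber ℛ X}) (i),
      ψ (Pi.single i ((1 : Blk d) i)) * idMat (X : Set V) = ψ (Pi.single i (p X i)) := by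
    intro X i
    rw [← hpψ, ← map_mul, single_mul_blk, Pi.one_apply, one_mul]
  have degA : ∀ i, degOf (adjAlg ℛ : Set (Matrix V V ℂ)) (ψ (Pi.single i ((1 : Blk d) i))) = d i :=
    fun i => degOf_eq ψ hψ 1 (one_mul 1) _ cA i (d i)
      (by rw [Pi.one_apply, Matrix.trace_one, Fintype.card_fin])
  have degX : ∀ (X : {X : Set V | IsFiber ℛ X}) (i),
      degOf (compAlgSet ℛ (X : Set V)) (ψ (Pi.single i (p X i))) = t X i :=
    fun X i => degOf_eq ψ hψ (p X) (pid X) _ (cX X) i (t X i) (ht X i)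
  constructor
  · rintro ⟨r, hr⟩
    have hsum : ∀ X Y, ∑ i, t X i * t Y i = r := fun X Y => by
      rw [← hdim]; exact hr _ _ X.2 Y.2
    have heq : ∀ X Y i, t X i = t Y i := by
      intro X Y
      have hsumZ : ∀ X Y, ∑ i, (t X i : ℤ) * (t Y i : ℤ) = r := fun X Y => by
        exact_mod_cast hsum X Y
      have h0 : ∑ i, ((t X i : ℤ) - t Y i) ^ 2 = 0 := by
        calc ∑ i, ((t X i : ℤ) - t Y i) ^ 2
            = ∑ i, ((t X i : ℤ) * t X i - t X i * t Y i - t X i * t Y i + t Y i * t Y i) :=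
              Finset.sum_congr rfl fun i _ => by ring
          _ = 0 := by
              rw [Finset.sum_add_distrib, Finset.sum_sub_distrib, Finset.sum_sub_distrib]
              simp only [hsumZ]
              ring
      intro i
      have h1 := (Finset.sum_eq_zero_iff_of_nonneg (fun i _ => sq_nonneg _)).1 h0 i
        (Finset.mem_univ i)
      have h2 := pow_eq_zero_iff (two_ne_zero) |>.1 h1
      omega
    have hdt : ∀ X i, d i = Nat.card {Y : Set V | IsFiber ℛ Y} * t X i := by
      intro X i
      rw [← hdsum, Finset.sum_congr rfl (fun Y _ => heq Y X i), Finset.sum_const,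
        Finset.card_univ, smul_eq_mul, Nat.card_eq_fintype_card]
    have pne : ∀ X i, p X i ≠ 0 := by
      intro X i h
      have h1 := ht X i
      rw [h, Matrix.trace_zero] at h1
      have h2 : t X i = 0 := by exact_mod_cast h1.symm
      exact hd i (by rw [hdt X i, h2, mul_zero])
    intro X₀ hX₀
    obtain ⟨X, rfl⟩ : ∃ X : {X : Set V | IsFiber ℛ X}, (X : Set V) = X₀ := ⟨⟨X₀, hX₀⟩, rfl⟩
    refine ⟨⟨?_, ?_, ?_⟩, ?_⟩
    · intro P hPm
      obtain ⟨i, rfl⟩ := (hP _).1 hPm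
      exact (hPX X _).2 ⟨i, pne X i, hmulX X i⟩
    · intro P hPm Q hQm hPQ
      obtain ⟨i, rfl⟩ := (hP _).1 hPm
      obtain ⟨j, rfl⟩ := (hP _).1 hQm
      simp only [hmulX] at hPQ
      have h1 := congrFun (hψ hPQ) i
      rw [Pi.single_eq_same] at h1
      by_cases hij : i = j
      · rw [hij]
      · rw [Pi.single_eq_of_ne hij] at h1
        exact absurd h1 (pne X i)
    · intro Q hQ
      obtain ⟨i, -, rfl⟩ := (hPX X _).1 hQ
      exact ⟨_, (hP _).2 ⟨i, rfl⟩, hmulX X i⟩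
    · intro P hPm
      obtain ⟨i, rfl⟩ := (hP _).1 hPm
      rw [degA, hmulX, degX]
      exact hdt X i
  · intro H
    have hdt : ∀ X i, d i = Nat.card {Y : Set V | IsFiber ℛ Y} * t X i := by
      intro X i
      have h1 := (H X X.2).2 _ ((hP _).2 ⟨i, rfl⟩)
      rwa [degA, hmulX, degX] at h1
    obtain ⟨X₀, hX₀, -⟩ := exists_fiber hCC (Classical.arbitrary V)
    have heq : ∀ X Y i, t X i = t Y i := by
      intro X Y i
      have h1 := (hdt X i).symm.trans (hdt Y i)
      refine Nat.eq_of_mul_eq_mul_left (Nat.pos_of_ne_zero fun h0 => hd i ?_) h1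
      rw [hdt X i, h0, zero_mul]
    refine ⟨∑ i, t ⟨X₀, hX₀⟩ i * t ⟨X₀, hX₀⟩ i, fun X Y hX hY => ?_⟩
    rw [hdim ⟨X, hX⟩ ⟨Y, hY⟩]
    exact Finset.sum_congr rfl fun i _ => by
      rw [heq ⟨X, hX⟩ ⟨X₀, hX₀⟩, heq ⟨Y, hY⟩ ⟨X₀, hX₀⟩]

end CCPaper
end

section
/- Let 𝒞 be a reduced (m,n,r)-scheme and p a prime. If p does not divide m and the homogeneous component 𝒞_X is p-valenced for some fiber X (i.e., d_R is a power of p for every R ∈ ℛ_X), then n = 1. -/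
open scoped Classical

namespace CCPaper

variable {V : Type*}

section aux
variable {V : Type*} [Fintype V]

noncomputable def oD (R : Set (V × V)) (x : V) : ℕ := (Finset.univ.filter fun y => (x, y) ∈ R).card
noncomputable def iD (R : Set (V × V)) (y : V) : ℕ := (Finset.univ.filter fun x => (x, y) ∈ R).card

lemma iNum_eq (R S : Set (V × V)) (x y : V) :
    iNum R S (x, y) = (Finset.univ.filter fun w => (x, w) ∈ R ∧ (w, y) ∈ S).card := by
  unfold iNum
  rw [Nat.card_eq_fintype_card]
  exact Fintype.card_subtype _

lemma oD_eq (R : Set (V × V)) (x : V) : oD R x = iNum R (transp R) (x, x) := by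
  rw [iNum_eq]; unfold oD; congr 1; ext y; simp [transp]

lemma iD_eq (R : Set (V × V)) (x : V) : iD R x = iNum (transp R) R (x, x) := by
  rw [iNum_eq]; unfold iD; congr 1; ext y; simp [transp]

variable {ℛ : Set (Set (V × V))}

lemma uniq (h : IsCC ℛ) {R S : Set (V × V)} (hR : R ∈ ℛ) (hS : S ∈ ℛ) {q : V × V}
    (h1 : q ∈ R) (h2 : q ∈ S) : R = S :=
  (h.2.1 q).unique ⟨hR, h1⟩ ⟨hS, h2⟩

lemma fst_mem (h : IsCC ℛ) {R : Set (V × V)} (hR : R ∈ ℛ) {X : Set V} (hX : IsFiber ℛ X)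
    {u v u' v' : V} (h1 : (u, v) ∈ R) (hu : u ∈ X) (h2 : (u', v') ∈ R) : u' ∈ X := by
  have e := h.2.2.2.2 _ hX.2 R hR R hR _ h1 _ h2
  rw [iNum_eq, iNum_eq] at e
  have : 0 < (Finset.univ.filter fun w => (u, w) ∈ diag X ∧ (w, v) ∈ R).card :=
    Finset.card_pos.2 ⟨u, by simp [diag, hu, h1]⟩
  rw [e] at this
  obtain ⟨w, hw⟩ := Finset.card_pos.1 this
  exact (Finset.mem_filter.1 hw).2.1.1

lemma snd_mem (h : IsCC ℛ) {R : Set (V × V)} (hR : R ∈ ℛ) {X : Set V} (hX : IsFiber ℛ X)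
    {u v u' v' : V} (h1 : (u, v) ∈ R) (hu : v ∈ X) (h2 : (u', v') ∈ R) : v' ∈ X :=
  fst_mem h (h.2.2.2.1 R hR) hX (u := v) (v := u) (u' := v') (v' := u') h1 hu h2

lemma mem_btw (h : IsCC ℛ) {R : Set (V × V)} (hR : R ∈ ℛ) {X Y : Set V} (hX : IsFiber ℛ X)
    (hY : IsFiber ℛ Y) {u v : V} (h1 : (u, v) ∈ R) (hu : u ∈ X) (hv : v ∈ Y) :
    R ∈ relsBtw ℛ X Y :=
  ⟨hR, fun _ hq => ⟨fst_mem h hR hX h1 hu hq, snd_mem h hR hY h1 hv hq⟩⟩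

lemma oD_const (h : IsCC ℛ) {R : Set (V × V)} (hR : R ∈ ℛ) {X : Set V} (hX : IsFiber ℛ X)
    {x x' : V} (hx : x ∈ X) (hx' : x' ∈ X) : oD R x = oD R x' := by
  rw [oD_eq, oD_eq]
  exact h.2.2.2.2 _ hR _ (h.2.2.2.1 R hR) _ hX.2 _ ⟨hx, rfl⟩ _ ⟨hx', rfl⟩

lemma iD_const (h : IsCC ℛ) {R : Set (V × V)} (hR : R ∈ ℛ) {X : Set V} (hX : IsFiber ℛ X)
    {x x' : V} (hx : x ∈ X) (hx' : x' ∈ X) : iD R x = iD R x' := by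
  rw [iD_eq, iD_eq]
  exact h.2.2.2.2 _ (h.2.2.2.1 R hR) _ hR _ hX.2 _ ⟨hx, rfl⟩ _ ⟨hx', rfl⟩

lemma card_fil (X : Set V) : Nat.card X = (Finset.univ.filter fun x => x ∈ X).card := by
  rw [Nat.card_eq_fintype_card]
  exact Fintype.card_subtype _

lemma deg_eq (h : IsCC ℛ) {X Y : Set V} (hX : IsFiber ℛ X)
    (hY : IsFiber ℛ Y) (hc : Nat.card X = Nat.card Y) {R : Set (V × V)}
    (hR : R ∈ relsBtw ℛ X Y) {x y : V} (hx : x ∈ X) (hy : y ∈ Y) : oD R x = iD R y := by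
  have key := Finset.card_mul_eq_card_mul (s := Finset.univ.filter fun x => x ∈ X)
    (t := Finset.univ.filter fun x => x ∈ Y) (fun a b => (a, b) ∈ R) (m := oD R x) (n := iD R y)
    (by
      intro a ha
      rw [oD_const h hR.1 hX hx (by simpa using ha)]
      unfold oD Finset.bipartiteAbove
      congr 1; ext b
      simp only [Finset.mem_filter, Finset.mem_univ, true_and, and_iff_right_iff_imp]
      exact fun hb => (hR.2 hb).2)
    (by
      intro a ha
      rw [iD_const h hR.1 hY hy (by simpa using ha)]
      unfold iD Finset.bipartiteBelow
      congr 1; ext b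
      simp only [Finset.mem_filter, Finset.mem_univ, true_and, and_iff_right_iff_imp]
      exact fun hb => (hR.2 hb).1)
  rw [← card_fil, ← card_fil, ← hc] at key
  have : 0 < Nat.card X := by
    rw [card_fil]; exact Finset.card_pos.2 ⟨x, by simpa using hx⟩
  exact Nat.eq_of_mul_eq_mul_left this key

lemma cnt_out (h : IsCC ℛ) {T R U : Set (V × V)} (hT : T ∈ ℛ) (hR : R ∈ ℛ) (hU : U ∈ ℛ)
    {x y w : V} (h1 : (x, y) ∈ U) (h2 : (x, w) ∈ T) :
    oD U x * iNum T R (x, y) = oD T x * iNum U (transp R) (x, w) := by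
  refine Finset.card_mul_eq_card_mul (s := Finset.univ.filter fun y => (x, y) ∈ U)
    (t := Finset.univ.filter fun w => (x, w) ∈ T) (fun y w => (w, y) ∈ R) ?_ ?_
  · intro a ha
    rw [h.2.2.2.2 _ hT _ hR _ hU _ h1 (x, a) (by simpa using ha), iNum_eq]
    congr 1; ext b; simp [Finset.bipartiteAbove]
  · intro a ha
    rw [h.2.2.2.2 _ hU _ (h.2.2.2.1 R hR) _ hT _ h2 (x, a) (by simpa using ha), iNum_eq]
    congr 1; ext b; simp [Finset.bipartiteBelow, transp]

lemma cnt_in (h : IsCC ℛ) {T R U : Set (V × V)} (hT : T ∈ ℛ) (hR : R ∈ ℛ) (hU : U ∈ ℛ)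
    {x y w : V} (h1 : (x, y) ∈ U) (h2 : (w, y) ∈ R) :
    iD U y * iNum T R (x, y) = iD R y * iNum (transp T) U (w, y) := by
  refine Finset.card_mul_eq_card_mul (s := Finset.univ.filter fun x => (x, y) ∈ U)
    (t := Finset.univ.filter fun w => (w, y) ∈ R) (fun x w => (x, w) ∈ T) ?_ ?_
  · intro a ha
    rw [h.2.2.2.2 _ hT _ hR _ hU _ h1 (a, y) (by simpa using ha), iNum_eq]
    congr 1; ext b; simp [Finset.bipartiteAbove, and_comm]
  · intro a ha
    rw [h.2.2.2.2 _ (h.2.2.2.1 T hT) _ hU _ hR _ h2 (a, y) (by simpa using ha), iNum_eq]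
    congr 1; ext b; simp [Finset.bipartiteBelow, transp, and_comm]

lemma key (h : IsCC ℛ) {X Y : Set V} (hX : IsFiber ℛ X)
    (hY : IsFiber ℛ Y) (hc : Nat.card X = Nat.card Y) {T R U : Set (V × V)}
    (hT : T ∈ relsBtw ℛ X X) (hR : R ∈ relsBtw ℛ X Y) (hU : U ∈ ℛ)
    {x w y : V} (h1 : (x, w) ∈ T) (h2 : (w, y) ∈ R) (h3 : (x, y) ∈ U)
    (hco : Nat.Coprime (oD R w) (oD T x)) {x' w' y' : V}
    (h1' : (x', w') ∈ T) (h2' : (w', y') ∈ R) : (x', y') ∈ U := by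
  have hx := (hT.2 h1).1
  have hw := (hT.2 h1).2
  have hw' : w' ∈ X := (hT.2 h1').2
  have hy : y ∈ Y := (hR.2 h2).2
  have hUb := mem_btw h hU hX hY h3 hx hy
  have e1 := cnt_out h hT.1 hR.1 hU h3 h1
  have e2 := cnt_in h hT.1 hR.1 hU h3 h2
  rw [← deg_eq h hX hY hc hUb hx hy, ← deg_eq h hX hY hc hR hw hy] at e2
  have hd : oD R w ∣ iNum U (transp R) (x, w) :=
    hco.dvd_of_dvd_mul_left (e1 ▸ e2 ▸ Dvd.intro _ rfl)
  have hpos : 0 < iNum U (transp R) (x, w) := by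
    rw [iNum_eq]; exact Finset.card_pos.2 ⟨y, by simp [transp, h2, h3]⟩
  have hle := Nat.le_of_dvd hpos hd
  rw [h.2.2.2.2 _ hU _ (h.2.2.2.1 R hR.1) _ hT.1 _ h1 _ h1', oD_const h hR.1 hX hw hw',
    iNum_eq] at hle
  have := Finset.eq_of_subset_of_card_le
    (s := Finset.univ.filter fun z => (x', z) ∈ U ∧ (z, w') ∈ transp R)
    (t := Finset.univ.filter fun z => (w', z) ∈ R)
    (by intro z; simp [transp]) hle
  have hm : y' ∈ Finset.univ.filter fun z => (w', z) ∈ R := by simpa using h2'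
  rw [← this] at hm
  simp at hm
  exact hm.1

lemma outDeg_eq (h : IsCC ℛ) {X Y : Set V} (hX : IsFiber ℛ X) {R : Set (V × V)}
    (hR : R ∈ relsBtw ℛ X Y) {x : V} (hx : x ∈ X) : outDeg R = oD R x := by
  have hne := h.1 R hR.1
  unfold outDeg
  rw [dif_pos hne, oD_const h hR.1 hX hx (hR.2 hne.choose_spec).1, Nat.card_eq_fintype_card]
  exact Fintype.card_subtype _

lemma inDeg_eq (h : IsCC ℛ) {X Y : Set V} (hY : IsFiber ℛ Y) {R : Set (V × V)}
    (hR : R ∈ relsBtw ℛ X Y) {y : V} (hy : y ∈ Y) : inDeg R = iD R y := by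
  have hne := h.1 R hR.1
  unfold inDeg
  rw [dif_pos hne, iD_const h hR.1 hY hy (hR.2 hne.choose_spec).2, Nat.card_eq_fintype_card]
  exact Fintype.card_subtype _

lemma exists_R (h : IsCC ℛ) {X Y : Set V} (hX : IsFiber ℛ X) (hY : IsFiber ℛ Y) {p : ℕ}
    (hp : ¬ p ∣ Nat.card Y) {x : V} (hx : x ∈ X) : ∃ R ∈ relsBtw ℛ X Y, ¬ p ∣ oD R x := by
  by_contra hcon
  push Not at hcon
  apply hp
  choose c hc using fun q : V × V => (h.2.1 q).exists
  rw [card_fil, Finset.card_eq_sum_card_image (fun y => c (x, y))]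
  refine Finset.dvd_sum fun S hS => ?_
  obtain ⟨y, hy, rfl⟩ := Finset.mem_image.1 hS
  have hy : y ∈ Y := by simpa using hy
  have hb := mem_btw h (hc (x, y)).1 hX hY (hc (x, y)).2 hx hy
  refine (hcon _ hb).trans (dvd_of_eq ?_)
  symm
  unfold oD
  congr 1; ext z
  simp only [Finset.mem_filter, Finset.mem_univ, true_and]
  constructor
  · rintro ⟨_, e⟩
    rw [← e]; exact (hc (x, z)).2
  · intro hz
    exact ⟨(hb.2 hz).2, uniq h (hc (x, z)).1 hb.1 (hc (x, z)).2 hz⟩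

lemma main_aux (h : IsCC ℛ) {r p : ℕ} (hp : p.Prime) (hbal : IsBalancedWith ℛ r) {X Y : Set V}
    (hX : IsFiber ℛ X) (hY : IsFiber ℛ Y) (hc : Nat.card X = Nat.card Y)
    (hpm : ¬ p ∣ Nat.card Y)
    (hval : ∀ R ∈ relsBtw ℛ X X, ∃ k : ℕ, outDeg R = p ^ k) :
    ∃ R ∈ relsBtw ℛ X Y, IsThin R := by
  obtain ⟨x0, hx0⟩ := hX.1
  obtain ⟨R, hR, hpR⟩ := exists_R h hX hY hpm hx0
  have hpos : ∀ w ∈ X, ∃ y, (w, y) ∈ R := by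
    intro w hw
    have : 0 < oD R w := by
      rw [oD_const h hR.1 hX hw hx0]
      exact Nat.pos_of_ne_zero fun e => hpR (e ▸ dvd_zero p)
    obtain ⟨y, hy⟩ := Finset.card_pos.1 this
    exact ⟨y, by simpa using hy⟩
  have hpos' : ∀ y ∈ Y, ∃ w, (w, y) ∈ R := by
    intro w hw
    have : 0 < iD R w := by
      rw [← deg_eq h hX hY hc hR hx0 hw]
      exact Nat.pos_of_ne_zero fun e => hpR (e ▸ dvd_zero p)
    obtain ⟨y, hy⟩ := Finset.card_pos.1 this
    exact ⟨y, by simpa using hy⟩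
  have hf : ∀ T : relsBtw ℛ X X, ∃ U : relsBtw ℛ X Y, ∀ x w y, (x, w) ∈ T.1 → (w, y) ∈ R →
      (x, y) ∈ U.1 := by
    rintro ⟨T, hT⟩
    obtain ⟨⟨x, w⟩, h1⟩ := h.1 T hT.1
    obtain ⟨y, h2⟩ := hpos w (hT.2 h1).2
    obtain ⟨U, hU, h3⟩ := (h.2.1 (x, y)).exists
    refine ⟨⟨U, mem_btw h hU hX hY h3 (hT.2 h1).1 (hR.2 h2).2⟩, fun x' w' y' h1' h2' => ?_⟩
    refine key h hX hY hc hT hR hU h1 h2 h3 ?_ h1' h2'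
    obtain ⟨k, hk⟩ := hval T hT
    rw [← outDeg_eq h hX hT (hT.2 h1).1, hk, oD_const h hR.1 hX (hT.2 h1).2 hx0]
    exact (Nat.Coprime.pow_left k ((Nat.Prime.coprime_iff_not_dvd hp).2 hpR)).symm
  choose f hf using hf
  have hsurj : Function.Surjective f := by
    rintro ⟨S, hS⟩
    obtain ⟨⟨x, y⟩, h1⟩ := h.1 S hS.1
    obtain ⟨w, h2⟩ := hpos' y (hS.2 h1).2
    obtain ⟨T, hT, h3⟩ := (h.2.1 (x, w)).exists
    have hTb := mem_btw h hT hX hX h3 (hS.2 h1).1 (hR.2 h2).1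
    refine ⟨⟨T, hTb⟩, Subtype.ext ?_⟩
    exact uniq h (f ⟨T, hTb⟩).2.1 hS.1 (hf ⟨T, hTb⟩ x w y h3 h2) h1
  have hinj : Function.Injective f := by
    refine (hsurj.bijective_of_nat_card_le ?_).1
    rw [hbal X X hX hX, hbal X Y hX hY]
  obtain ⟨y, hy⟩ := hpos x0 hx0
  have hyY : y ∈ Y := (hR.2 hy).2
  have hi : iD R y = 1 := by
    refine Finset.card_eq_one.2 ⟨x0, ?_⟩
    ext x
    simp only [Finset.mem_filter, Finset.mem_univ, true_and, Finset.mem_singleton]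
    refine ⟨fun hx => ?_, fun e => e ▸ hy⟩
    obtain ⟨T, hT, h3⟩ := (h.2.1 (x, x0)).exists
    have hxX : x ∈ X := (hR.2 hx).1
    have hTb := mem_btw h hT hX hX h3 hxX hx0
    have hDb : diag X ∈ relsBtw ℛ X X :=
      mem_btw h hX.2 hX hX (u := x) (v := x) ⟨hxX, rfl⟩ hxX hxX
    have e : f ⟨T, hTb⟩ = f ⟨diag X, hDb⟩ := Subtype.ext <|
      uniq h (f ⟨T, hTb⟩).2.1 (f ⟨diag X, hDb⟩).2.1 (hf ⟨T, hTb⟩ x x0 y h3 hy)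
        (hf ⟨diag X, hDb⟩ x x y ⟨hxX, rfl⟩ hx)
    have e2 : T = diag X := congrArg Subtype.val (hinj e)
    rw [e2] at h3
    exact h3.2
  refine ⟨R, hR, ?_, ?_⟩
  · rw [outDeg_eq h hX hR hx0, deg_eq h hX hY hc hR hx0 hyY, hi]
  · rw [inDeg_eq h hY hR hyY, hi]

end aux

/-- **Theorem (Statement 4).** If `𝒞` is a reduced `(m,n,r)`-scheme, `p` is a prime not
dividing `m`, and some homogeneous component `𝒞_X` is `p`-valenced, then `n = 1`. -/
theorem reduced_p_valenced
    {V : Type*} [Fintype V] [Nonempty V]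
    (ℛ : Set (Set (V × V))) (m n r p : ℕ) (hp : p.Prime)
    (h : IsMNRScheme ℛ m n r) (hred : IsReduced ℛ) (hpm : ¬ p ∣ m)
    (hX : ∃ X : Set V, IsFiber ℛ X ∧
      ∀ R ∈ relsBtw ℛ X X, ∃ k : ℕ, outDeg R = p ^ k) :
    n = 1 := by
  obtain ⟨hcc, hbal, hm, hn⟩ := h
  obtain ⟨X, hXf, hval⟩ := hX
  have : {X : Set V | IsFiber ℛ X} = {X} := by
    ext Y
    simp only [Set.mem_ofPred_eq, Set.mem_singleton_iff]
    refine ⟨fun hY => ?_, fun e => e ▸ hXf⟩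
    by_contra hne
    obtain ⟨R, hR, ht⟩ := main_aux hcc hp hbal hXf hY ((hm X hXf).trans (hm Y hY).symm)
      (by rwa [hm Y hY]) hval
    exact hred X Y hXf hY (fun e => hne e.symm) R hR ht
  rw [← hn, this]
  simp

end CCPaper
end

section
/- If 𝒞 is a reduced (m,n,r)-scheme and m ≤ 11, then n ≤ 2. -/
open scoped Classical

namespace CCPaper

variable {V : Type*}

/-- sorted lists of given length with entries at least `lo` and given sum -/
def parts : ℕ → ℕ → ℕ → List (List ℕ)
  | 0, _, m => if m = 0 then [[]] else []
  | k+1, lo, m => (List.range (m+1)).flatMap fun a =>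
      if lo ≤ a then (parts k a (m-a)).map (fun l => a :: l) else []

theorem mem_parts : ∀ (l : List ℕ) (lo m : ℕ), l.Pairwise (· ≤ ·) → (∀ x ∈ l, lo ≤ x) →
    l.sum = m → l ∈ parts l.length lo m
  | [], lo, m, _, _, h => by
      simp at h; subst h; simp [parts]
  | a :: t, lo, m, hp, hlo, h => by
      rw [List.pairwise_cons] at hp
      simp only [List.sum_cons] at h
      simp only [List.length_cons, parts, List.mem_flatMap, List.mem_range]
      refine ⟨a, by omega, ?_⟩
      rw [if_pos (hlo a (by simp))]
      exact List.mem_map.2 ⟨t, mem_parts t a (m-a) hp.2 hp.1 (by omega), rfl⟩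

def vecs (D dj : ℕ) : List (ℕ × ℕ) → ℕ → List (List (ℕ × ℕ))
  | [], rem => if rem = 0 then [[]] else []
  | (e, c) :: t, rem => (List.range (min rem c / (Nat.lcm (Nat.lcm D dj) e) + 1)).flatMap fun q =>
      (vecs D dj t (rem - Nat.lcm (Nat.lcm D dj) e * q)).map
        (fun l => (e, c - Nat.lcm (Nat.lcm D dj) e * q) :: l)

theorem mem_vecs {κ : Type*} (D dj : ℕ) (hD : 0 < D) (hj : 0 < dj) (ek col f : κ → ℕ) :
    ∀ (ks : List κ), (∀ k ∈ ks, f k ≤ col k) → (∀ k ∈ ks, 0 < ek k) →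
    (∀ k ∈ ks, D ∣ f k ∧ dj ∣ f k ∧ ek k ∣ f k) →
    (ks.map fun k => (ek k, col k - f k)) ∈
      vecs D dj (ks.map fun k => (ek k, col k)) (ks.map f).sum
  | [], _, _, _ => by simp [vecs]
  | k :: t, h1, h2, h3 => by
      have ih := mem_vecs D dj hD hj ek col f t (fun x hx => h1 x (by simp [hx]))
        (fun x hx => h2 x (by simp [hx])) (fun x hx => h3 x (by simp [hx]))
      obtain ⟨ha, hb, hc⟩ := h3 k (by simp)
      have hL : Nat.lcm (Nat.lcm D dj) (ek k) ∣ f k := Nat.lcm_dvd (Nat.lcm_dvd ha hb) hc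
      have hLp : 0 < Nat.lcm (Nat.lcm D dj) (ek k) :=
        Nat.lcm_pos (Nat.lcm_pos hD hj) (h2 k (by simp))
      have h1k := h1 k (by simp)
      simp only [List.map_cons, List.sum_cons, vecs, List.mem_flatMap, List.mem_range]
      obtain ⟨q, hq⟩ := hL
      refine ⟨q, ?_, ?_⟩
      · rw [Nat.lt_succ_iff, Nat.le_div_iff_mul_le hLp]
        rw [mul_comm, ← hq]
        exact le_min (by omega) h1k
      · rw [← hq]
        rw [Nat.add_sub_cancel_left]
        exact List.mem_map.2 ⟨_, ih, rfl⟩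

def rowSearch (D : ℕ) : List (ℕ × ℕ) → List (ℕ × ℕ) → Bool
  | [], cols => cols.all (fun x => x.2 == 0)
  | (dj, rem) :: t, cols => (vecs D dj cols rem).any (rowSearch D t)

theorem rowSearch_sound {ι κ : Type*} (D : ℕ) (hD : 0 < D) (dj : ι → ℕ) (ek : κ → ℕ)
    (f : ι → κ → ℕ) (ks : List κ) (hek : ∀ k ∈ ks, 0 < ek k) :
    ∀ (js : List ι) (col : κ → ℕ), (∀ j ∈ js, 0 < dj j) →
    (∀ j ∈ js, ∀ k ∈ ks, D ∣ f j k ∧ dj j ∣ f j k ∧ ek k ∣ f j k) →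
    (∀ k ∈ ks, col k = (js.map fun j => f j k).sum) →
    rowSearch D (js.map fun j => (dj j, (ks.map (f j)).sum)) (ks.map fun k => (ek k, col k)) = true
  | [], col, _, _, h => by
      simp only [List.map_nil, List.sum_nil] at h
      simp only [List.map_nil, rowSearch, List.all_map, List.all_eq_true]
      intro k hk; simp [h k hk]
  | j :: t, col, hj, hd, h => by
      simp only [List.map_cons, List.sum_cons] at h
      simp only [List.map_cons, rowSearch, List.any_eq_true]
      refine ⟨_, mem_vecs D (dj j) hD (hj j (by simp)) ek col (f j) ks
        (fun k hk => by rw [h k hk]; omega) hek (fun k hk => hd j (by simp) k hk), ?_⟩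
      refine rowSearch_sound D hD dj ek f ks hek t (fun k => col k - f j k)
        (fun x hx => hj x (by simp [hx])) (fun x hx => hd x (by simp [hx])) ?_
      intro k hk
      simp only [h k hk]; omega

def checkRow (s : ℕ) (d e : Fin (s+1) → ℕ) (a : Fin (s+1)) : Bool :=
  rowSearch (d a) ((List.finRange (s+1)).map fun j => (d j, d a * d j - if a = j then d a else 0))
    ((List.finRange s).map fun k => (e k.succ, d a * e k.succ))

def checkAll (s : ℕ) (d e : Fin (s+1) → ℕ) : Bool :=
  (List.finRange (s+1)).all (checkRow s d e)

def toFn (n : ℕ) (l : List ℕ) : Fin n → ℕ := fun i => l.getD i 0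

def cands (m s : ℕ) : List (List ℕ × List ℕ) :=
  (parts (s+1) 2 m).flatMap fun l =>
    ((parts s 1 (m-1)).map fun l' => (l, 1 :: l')).filter fun p =>
      checkAll s (toFn (s+1) p.1) (toFn (s+1) p.2)

theorem cands_sound (m s : ℕ) (d e : Fin (s+1) → ℕ) (U : Fin (s+1) → Fin (s+1) → Fin (s+1) → ℕ)
    (d2 : ∀ a, 2 ≤ d a) (dm : Monotone d) (em : Monotone e) (e0 : e 0 = 1)
    (ds : ∑ a, d a = m) (es : ∑ a, e a = m)
    (U0 : ∀ a b, U a b 0 = if a = b then d a else 0)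
    (Uk : ∀ a b, ∑ k, U a b k = d a * d b)
    (Ub : ∀ a k, ∑ b, U a b k = d a * e k)
    (Ud : ∀ a b k, d a ∣ U a b k ∧ d b ∣ U a b k ∧ e k ∣ U a b k) :
    ∃ p ∈ cands m s, d = toFn (s+1) p.1 ∧ e = toFn (s+1) p.2 := by
  have hto : ∀ (n : ℕ) (g : Fin n → ℕ), toFn n (List.ofFn g) = g := by
    intro n g; funext i; simp [toFn]
  have epos : ∀ k, 0 < e k := fun k => by
    have := em (Fin.zero_le k); omega
  have he : List.ofFn e = 1 :: List.ofFn (fun i : Fin s => e i.succ) := by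
    rw [List.ofFn_succ, e0]
  refine ⟨(List.ofFn d, List.ofFn e), ?_, (hto _ _).symm, (hto _ _).symm⟩
  simp only [cands, List.mem_flatMap, List.mem_filter, List.mem_map]
  refine ⟨List.ofFn d, ?_, ⟨List.ofFn (fun i : Fin s => e i.succ), ?_, by rw [he]⟩, ?_⟩
  · have := mem_parts (List.ofFn d) 2 m (by
      rw [List.pairwise_ofFn]; intro i j hij; exact dm hij.le) (by
      intro x hx; rw [List.mem_ofFn] at hx; obtain ⟨i, rfl⟩ := hx; exact d2 i)
      (by rw [List.sum_ofFn, ds])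
    simpa using this
  · have := mem_parts (List.ofFn (fun i : Fin s => e i.succ)) 1 (m-1) (by
      rw [List.pairwise_ofFn]; intro i j hij; exact em (Fin.succ_le_succ_iff.2 hij.le)) (by
      intro x hx; rw [List.mem_ofFn] at hx; obtain ⟨i, rfl⟩ := hx; exact epos _)
      (by rw [List.sum_ofFn, ← es, Fin.sum_univ_succ, e0]; omega)
    simpa using this
  · simp only [hto]
    rw [checkAll, List.all_eq_true]
    intro a _
    have key := rowSearch_sound (d a) (by have := d2 a; omega) d (fun k : Fin s => e k.succ)
      (fun j k => U a j k.succ) (List.finRange s) (fun k _ => epos _) (List.finRange (s+1))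
      (fun k => d a * e k.succ) (fun j _ => by have := d2 j; omega)
      (fun j _ k _ => Ud a j k.succ) (fun k _ => by
        rw [← Ub a k.succ, ← List.ofFn_eq_map, List.sum_ofFn])
    rw [checkRow]
    convert key using 5 with j
    rw [← List.ofFn_eq_map, List.sum_ofFn, ← Uk a j, Fin.sum_univ_succ, U0]
    simp

theorem cands_7_1 : cands 7 1 = [([3,4],[1,6])] := by decide +kernel
theorem cands_s1 : ∀ m < 12, m ≠ 7 → m ≠ 11 → cands m 1 = [] := by decide +kernel
theorem cands_11_1 : cands 11 1 = [([5,6],[1,10])] := by decide +kernel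
theorem cands_6_2 : cands 6 2 = [([2,2,2],[1,1,4])] := by decide +kernel
theorem cands_8_2 : cands 8 2 = [([2,3,3],[1,1,6])] := by decide +kernel
theorem cands_10_2 : cands 10 2 = [([2,4,4],[1,1,8]),([3,3,4],[1,3,6])] := by decide +kernel
theorem cands_11_2 : cands 11 2 = [([3,4,4],[1,4,6])] := by decide +kernel
theorem cands_s2 : ∀ m < 12, m ≠ 6 → m ≠ 8 → m ≠ 10 → m ≠ 11 → cands m 2 = [] := by
  decide +kernel
theorem cands_8_3 : cands 8 3 = [([2,2,2,2],[1,1,2,4])] := by decide +kernel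
theorem cands_10_3 : cands 10 3 = [([2,2,2,4],[1,1,4,4]),([2,2,3,3],[1,1,2,6])] := by
  decide +kernel
theorem cands_11_3 : cands 11 3 = [([2,3,3,3],[1,1,3,6])] := by decide +kernel
theorem cands_s3 : ∀ m < 12, m ≠ 8 → m ≠ 10 → m ≠ 11 → cands m 3 = [] := by decide +kernel
theorem cands_10_4 : cands 10 4 = [([2,2,2,2,2],[1,1,2,2,4])] := by decide +kernel
theorem cands_s4 : ∀ m < 12, m ≠ 10 → cands m 4 = [] := by decide +kernel

structure Sys (m s : ℕ) where
  d : Fin 3 → Fin 3 → Fin (s+1) → ℕ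
  e : Fin 3 → Fin (s+1) → ℕ
  U : Fin 3 → Fin 3 → Fin (s+1) → Fin (s+1) → Fin (s+1) → ℕ
  N : Fin 3 → Fin 3 → Fin 3 → Fin (s+1) → Fin (s+1) → Fin (s+1) → ℕ
  d2 : ∀ i j, i ≠ j → ∀ a, 2 ≤ d i j a
  dm : ∀ i j, i ≠ j → Monotone (d i j)
  em : ∀ i, Monotone (e i)
  e0 : ∀ i, e i 0 = 1
  ds : ∀ i j, i ≠ j → ∑ a, d i j a = m
  es : ∀ i, ∑ a, e i a = m
  dsymm : ∀ i j, i ≠ j → d j i = d i j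
  U0 : ∀ i j, i ≠ j → ∀ a b, U i j a b 0 = if a = b then d i j a else 0
  Uk : ∀ i j, i ≠ j → ∀ a b, ∑ k, U i j a b k = d i j a * d i j b
  Ub : ∀ i j, i ≠ j → ∀ a k, ∑ b, U i j a b k = d i j a * e j k
  Ua : ∀ i j, i ≠ j → ∀ b k, ∑ a, U i j a b k = d i j b * e j k
  Ud : ∀ i j, i ≠ j → ∀ a b k, d i j a ∣ U i j a b k ∧ d i j b ∣ U i j a b k ∧ e j k ∣ U i j a b k
  Nc : ∀ i j k, i ≠ j → j ≠ k → i ≠ k → ∀ a b, ∑ c, N i j k a b c = d i j a * d j k b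
  Nb : ∀ i j k, i ≠ j → j ≠ k → i ≠ k → ∀ a c, ∑ b, N i j k a b c = d i j a * d i k c
  Na : ∀ i j k, i ≠ j → j ≠ k → i ≠ k → ∀ b c, ∑ a, N i j k a b c = d j k b * d i k c
  Nd : ∀ i j k, i ≠ j → j ≠ k → i ≠ k → ∀ a b c,
    d i j a ∣ N i j k a b c ∧ d j k b ∣ N i j k a b c ∧ d i k c ∣ N i j k a b c
  Q1 : ∀ i j k, i ≠ j → j ≠ k → i ≠ k → ∀ a b,
    ∑ c, N i j k a b c * N i j k a b c / d i k c =
      ∑ x, U i j a a x * U k j b b x / e j x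
  Q2 : ∀ i j, i ≠ j → ∀ a b,
    ∑ x, U i j a b x * U i j a b x / e j x = ∑ x, U j i a a x * U j i b b x / e i x

namespace Sys
variable {m s : ℕ} (S : Sys m s)

theorem cand (S : Sys m s) {i j : Fin 3} (h : i ≠ j) :
    ∃ p ∈ cands m s, S.d i j = toFn (s+1) p.1 ∧ S.e j = toFn (s+1) p.2 :=
  cands_sound m s (S.d i j) (S.e j) (S.U i j) (S.d2 i j h) (S.dm i j h) (S.em j) (S.e0 j)
    (S.ds i j h) (S.es j) (S.U0 i j h) (S.Uk i j h) (S.Ub i j h) (S.Ud i j h)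

theorem ne_nil (S : Sys m s) : cands m s ≠ [] := by
  intro h
  obtain ⟨p, hp, _⟩ := S.cand (i := 0) (j := 1) (by decide)
  rw [h] at hp; simp at hp

theorem single (S : Sys m s) {l l' : List ℕ} (h : cands m s = [(l, l')]) :
    (∀ i j, i ≠ j → S.d i j = toFn (s+1) l) ∧ ∀ j, S.e j = toFn (s+1) l' := by
  have key : ∀ i j, i ≠ j → S.d i j = toFn (s+1) l ∧ S.e j = toFn (s+1) l' := by
    intro i j hij
    obtain ⟨p, hp, h1, h2⟩ := S.cand hij
    rw [h] at hp; simp at hp; subst hp; exact ⟨h1, h2⟩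
  refine ⟨fun i j hij => (key i j hij).1, fun j => ?_⟩
  obtain ⟨i, hi⟩ := exists_ne j
  exact (key i j hi).2

theorem double (S : Sys m s) {l l' k k' : List ℕ} (h : cands m s = [(l, l'), (k, k')])
    (hne : toFn (s+1) l ≠ toFn (s+1) k) (hne' : toFn (s+1) l' ≠ toFn (s+1) k') :
    ((∀ i j, i ≠ j → S.d i j = toFn (s+1) l) ∧ ∀ j, S.e j = toFn (s+1) l') ∨
    ((∀ i j, i ≠ j → S.d i j = toFn (s+1) k) ∧ ∀ j, S.e j = toFn (s+1) k') := by
  have key : ∀ i j, i ≠ j → (S.d i j = toFn (s+1) l ∧ S.e j = toFn (s+1) l') ∨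
      (S.d i j = toFn (s+1) k ∧ S.e j = toFn (s+1) k') := by
    intro i j hij
    obtain ⟨p, hp, h1, h2⟩ := S.cand hij
    rw [h] at hp; simp at hp
    rcases hp with hp | hp <;> subst hp
    · exact Or.inl ⟨h1, h2⟩
    · exact Or.inr ⟨h1, h2⟩
  have step : ∀ i j, i ≠ j → (S.e i = toFn (s+1) l' ↔ S.e j = toFn (s+1) l') := by
    intro i j hij
    have h1 := key i j hij
    have h2 := key j i hij.symm
    rw [S.dsymm i j hij] at h2
    rcases h1 with ⟨a, b⟩ | ⟨a, b⟩ <;> rcases h2 with ⟨a', b'⟩ | ⟨a', b'⟩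
    · simp [b, b']
    · exact absurd (a.symm.trans a') hne
    · exact absurd (a'.symm.trans a) hne
    · simp [b, b']
  have cov : ∀ j, S.e j = toFn (s+1) l' ∨ S.e j = toFn (s+1) k' := by
    intro j
    obtain ⟨i, hi⟩ := exists_ne j
    rcases key i j hi with h | h
    · exact Or.inl h.2
    · exact Or.inr h.2
  rcases cov 0 with h0 | h0
  · left
    have hall : ∀ j, S.e j = toFn (s+1) l' := by
      intro j
      by_cases hj : j = 0
      · rw [hj]; exact h0
      · exact (step 0 j (Ne.symm hj)).1 h0
    refine ⟨fun i j hij => ?_, hall⟩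
    rcases key i j hij with h | h
    · exact h.1
    · exact absurd ((hall j).symm.trans h.2) hne'
  · right
    have hall : ∀ j, S.e j = toFn (s+1) k' := by
      intro j
      by_cases hj : j = 0
      · rw [hj]; exact h0
      · rcases cov j with h | h
        · exact absurd (((step 0 j (Ne.symm hj)).2 h).symm.trans h0) hne'
        · exact h
    refine ⟨fun i j hij => ?_, hall⟩
    rcases key i j hij with h | h
    · exact absurd (h.2.symm.trans (hall j)) hne'
    · exact h.1

theorem case_7_1 (S : Sys 7 1) : False := by
  obtain ⟨hd, he⟩ := S.single cands_7_1
  have hU : ∀ i j, i ≠ j → S.U i j 0 0 0 = 3 ∧ S.U i j 0 0 1 = 6 := by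
    intro i j h
    have h0 := S.U0 i j h 0 0
    have h1 := S.Uk i j h 0 0
    simp [Fin.sum_univ_two, hd i j h, toFn] at h0 h1
    omega
  have q := S.Q1 0 1 2 (by decide) (by decide) (by decide) 0 0
  have n := S.Nc 0 1 2 (by decide) (by decide) (by decide) 0 0
  have n0 := S.Nd 0 1 2 (by decide) (by decide) (by decide) 0 0 0
  have n1 := S.Nd 0 1 2 (by decide) (by decide) (by decide) 0 0 1
  have u := hU 0 1 (by decide)
  have v := hU 2 1 (by decide)
  simp [Fin.sum_univ_two, hd, he, toFn, u, v] at q n n0 n1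
  generalize S.N 0 1 2 0 0 0 = x at *
  generalize S.N 0 1 2 0 0 1 = y at *
  have : y = 0 := by omega
  have : x = 9 := by omega
  subst_vars
  simp at q

theorem case_11_1 (S : Sys 11 1) : False := by
  obtain ⟨hd, he⟩ := S.single cands_11_1
  have hU : ∀ i j, i ≠ j → S.U i j 0 0 0 = 5 ∧ S.U i j 0 0 1 = 20 := by
    intro i j h
    have h0 := S.U0 i j h 0 0
    have h1 := S.Uk i j h 0 0
    simp [Fin.sum_univ_two, hd i j h, toFn] at h0 h1
    omega
  have q := S.Q1 0 1 2 (by decide) (by decide) (by decide) 0 0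
  have n := S.Nc 0 1 2 (by decide) (by decide) (by decide) 0 0
  have n0 := S.Nd 0 1 2 (by decide) (by decide) (by decide) 0 0 0
  have n1 := S.Nd 0 1 2 (by decide) (by decide) (by decide) 0 0 1
  have u := hU 0 1 (by decide)
  have v := hU 2 1 (by decide)
  simp [Fin.sum_univ_two, hd, he, toFn, u, v] at q n n0 n1
  generalize S.N 0 1 2 0 0 0 = x at *
  generalize S.N 0 1 2 0 0 1 = y at *
  have : y = 0 := by omega
  have : x = 25 := by omega
  subst_vars
  simp at q

theorem case_6_2 (S : Sys 6 2) : False := by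
  obtain ⟨hd, he⟩ := S.single cands_6_2
  have hU : ∀ a, S.U 1 0 a a 0 = 2 ∧ S.U 1 0 a a 1 = 2 ∧ S.U 1 0 a a 2 = 0 := by
    intro a
    have h0 := S.U0 1 0 (by decide) a a
    have h1 := S.Uk 1 0 (by decide) a a
    have h2 := S.Ud 1 0 (by decide) a a 2
    fin_cases a <;>
    simp [Fin.sum_univ_three, hd, he, toFn] at h0 h1 h2 ⊢ <;>
    omega
  have q := S.Q2 0 1 (by decide) 0 1
  have h0 := S.U0 0 1 (by decide) 0 1
  have n := S.Uk 0 1 (by decide) 0 1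
  have n1 := S.Ud 0 1 (by decide) 0 1 1
  have n2 := S.Ud 0 1 (by decide) 0 1 2
  simp [Fin.sum_univ_three, hd, he, toFn, hU] at q n n1 n2 h0
  generalize S.U 0 1 0 1 0 = z at *
  generalize S.U 0 1 0 1 1 = x at *
  generalize S.U 0 1 0 1 2 = y at *
  have : (x = 4 ∧ y = 0) ∨ (x = 0 ∧ y = 4) := by omega
  rcases this with ⟨rfl, rfl⟩ | ⟨rfl, rfl⟩ <;> simp [h0] at q

theorem case_8_2 (S : Sys 8 2) : False := by
  obtain ⟨hd, he⟩ := S.single cands_8_2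
  have h0 := S.U0 0 1 (by decide) 0 0
  have h1 := S.Uk 0 1 (by decide) 0 0
  have h2 := S.Ud 0 1 (by decide) 0 0 2
  have g0 := S.U0 2 1 (by decide) 1 1
  have g1 := S.Uk 2 1 (by decide) 1 1
  have g2 := S.Ud 2 1 (by decide) 1 1 2
  have g3 := S.Ub 2 1 (by decide) 1 1
  have q := S.Q1 0 1 2 (by decide) (by decide) (by decide) 0 1
  have n := S.Nc 0 1 2 (by decide) (by decide) (by decide) 0 1
  have n0 := S.Nd 0 1 2 (by decide) (by decide) (by decide) 0 1 0
  have n1 := S.Nd 0 1 2 (by decide) (by decide) (by decide) 0 1 1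
  have n2 := S.Nd 0 1 2 (by decide) (by decide) (by decide) 0 1 2
  simp [Fin.sum_univ_three, hd, he, toFn] at h0 h1 h2 g0 g1 g2 g3 q n n0 n1 n2
  have e1 : S.U 0 1 0 0 1 = 2 := by omega
  have e2 : S.U 0 1 0 0 2 = 0 := by omega
  have e3 : S.U 2 1 1 1 1 = 0 := by omega
  simp [h0, g0, e1, e2, e3] at q
  generalize S.N 0 1 2 0 1 0 = x at *
  generalize S.N 0 1 2 0 1 1 = y at *
  generalize S.N 0 1 2 0 1 2 = z at *
  have : (x = 6 ∧ y = 0 ∧ z = 0) ∨ (x = 0 ∧ y = 6 ∧ z = 0) ∨ (x = 0 ∧ y = 0 ∧ z = 6) := by omega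
  rcases this with ⟨rfl, rfl, rfl⟩ | ⟨rfl, rfl, rfl⟩ | ⟨rfl, rfl, rfl⟩ <;> simp at q

theorem case_10_2 (S : Sys 10 2) : False := by
  rcases S.double cands_10_2 (by decide) (by decide) with ⟨hd, he⟩ | ⟨hd, he⟩
  · have hU : ∀ a, a ≠ 0 → S.U 1 0 a a 0 = 4 ∧ S.U 1 0 a a 1 = 4 ∧ S.U 1 0 a a 2 = 8 := by
      intro a ha
      have h0 := S.U0 1 0 (by decide) a a
      have h1 := S.Uk 1 0 (by decide) a a
      have h2 := S.Ud 1 0 (by decide) a a 2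
      have h4 := S.Ud 1 0 (by decide) a a 1
      have h3 := S.Ub 1 0 (by decide) a 1
      fin_cases a
      · simp at ha
      all_goals
        simp [Fin.sum_univ_three, hd, he, toFn] at h0 h1 h2 h3 h4 ⊢
        omega
    have q := S.Q2 0 1 (by decide) 1 2
    have h0 := S.U0 0 1 (by decide) 1 2
    have n := S.Uk 0 1 (by decide) 1 2
    have n1 := S.Ud 0 1 (by decide) 1 2 1
    have n2 := S.Ud 0 1 (by decide) 1 2 2
    simp [Fin.sum_univ_three, hd, he, toFn, hU] at q n n1 n2 h0
    generalize S.U 0 1 1 2 0 = z at *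
    generalize S.U 0 1 1 2 1 = x at *
    generalize S.U 0 1 1 2 2 = y at *
    have : (x = 0 ∧ y = 16) ∨ (x = 8 ∧ y = 8) ∨ (x = 16 ∧ y = 0) := by omega
    rcases this with ⟨rfl, rfl⟩ | ⟨rfl, rfl⟩ | ⟨rfl, rfl⟩ <;> simp [h0] at q
  · have hN : ∀ a, a ≠ 2 → S.N 0 1 2 a 2 2 = 12 := by
      intro a ha
      have n := S.Nc 0 1 2 (by decide) (by decide) (by decide) a 2
      have n0 := S.Nd 0 1 2 (by decide) (by decide) (by decide) a 2 0
      have n1 := S.Nd 0 1 2 (by decide) (by decide) (by decide) a 2 1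
      have b0 := S.Nb 0 1 2 (by decide) (by decide) (by decide) a 0
      have b1 := S.Nb 0 1 2 (by decide) (by decide) (by decide) a 1
      fin_cases a
      rotate_right
      · simp at ha
      all_goals
        simp [Fin.sum_univ_three, hd, toFn] at n n0 n1 b0 b1 ⊢
        omega
    have := S.Na 0 1 2 (by decide) (by decide) (by decide) 2 2
    simp [Fin.sum_univ_three, hd, toFn, hN] at this
    omega

theorem case_11_2 (S : Sys 11 2) : False := by
  obtain ⟨hd, he⟩ := S.single cands_11_2
  have h0 := S.U0 0 1 (by decide) 0 0
  have h1 := S.Uk 0 1 (by decide) 0 0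
  have h2 := S.Ud 0 1 (by decide) 0 0 1
  have g0 := S.U0 2 1 (by decide) 1 1
  have g1 := S.Uk 2 1 (by decide) 1 1
  have g2 := S.Ud 2 1 (by decide) 1 1 2
  have q := S.Q1 0 1 2 (by decide) (by decide) (by decide) 0 1
  have n := S.Nc 0 1 2 (by decide) (by decide) (by decide) 0 1
  have n0 := S.Nd 0 1 2 (by decide) (by decide) (by decide) 0 1 0
  have n1 := S.Nd 0 1 2 (by decide) (by decide) (by decide) 0 1 1
  have n2 := S.Nd 0 1 2 (by decide) (by decide) (by decide) 0 1 2
  simp [Fin.sum_univ_three, hd, he, toFn] at h0 h1 h2 g0 g1 g2 q n n0 n1 n2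
  have e1 : S.U 0 1 0 0 1 = 0 := by omega
  have e2 : S.U 0 1 0 0 2 = 6 := by omega
  have e3 : S.U 2 1 1 1 2 = 0 ∨ S.U 2 1 1 1 2 = 12 := by omega
  generalize S.N 0 1 2 0 1 0 = x at *
  generalize S.N 0 1 2 0 1 1 = y at *
  generalize S.N 0 1 2 0 1 2 = z at *
  have : (x = 12 ∧ y = 0 ∧ z = 0) ∨ (x = 0 ∧ y = 12 ∧ z = 0) ∨ (x = 0 ∧ y = 0 ∧ z = 12) := by
    omega
  rcases this with ⟨rfl, rfl, rfl⟩ | ⟨rfl, rfl, rfl⟩ | ⟨rfl, rfl, rfl⟩ <;>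
    rcases e3 with e3 | e3 <;> simp [h0, g0, e1, e2, e3] at q

theorem case_8_3 (S : Sys 8 3) : False := by
  obtain ⟨hd, he⟩ := S.single cands_8_3
  have ty : ∀ i j, i ≠ j → ∀ a, (S.U i j a a 0 = 2 ∧ S.U i j a a 3 = 0) ∧
      ((S.U i j a a 1 = 2 ∧ S.U i j a a 2 = 0) ∨ (S.U i j a a 1 = 0 ∧ S.U i j a a 2 = 2)) := by
    intro i j h a
    have h0 := S.U0 i j h a a
    have h1 := S.Uk i j h a a
    have h2 := S.Ud i j h a a 1
    have h3 := S.Ud i j h a a 2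
    have h4 := S.Ud i j h a a 3
    fin_cases a <;>
    simp [Fin.sum_univ_four, hd i j h, he, toFn] at h0 h1 h2 h3 h4 ⊢ <;> omega
  have al : ∀ i j, i ≠ j → ¬ ∀ a, S.U i j a a 1 = 2 := by
    intro i j h hA
    have hA' : ∀ a, S.U j i a a 1 = 2 := by
      intro a
      have q := S.Q2 i j h a a
      obtain ⟨⟨u0, u3⟩, u⟩ := ty i j h a
      obtain ⟨⟨v0, v3⟩, v⟩ := ty j i h.symm a
      have hh := hA a
      rcases v with ⟨v1, v2⟩ | ⟨v1, v2⟩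
      · exact v1
      · rcases u with ⟨u1, u2⟩ | ⟨u1, u2⟩
        · simp [Fin.sum_univ_four, he, toFn, u0, u1, u2, u3, v0, v1, v2, v3] at q
        · omega
    have key : ∀ b, S.U i j 0 b 3 = 0 := by
      intro b
      by_cases hb : b = 0
      · subst hb; exact (ty i j h 0).1.2
      have q := S.Q2 i j h 0 b
      have h0 := S.U0 i j h 0 b
      rw [if_neg (Ne.symm hb)] at h0
      have h1 := S.Uk i j h 0 b
      have h2 := S.Ud i j h 0 b 1
      have h3 := S.Ud i j h 0 b 2
      have h4 := S.Ud i j h 0 b 3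
      have a1 := hA' 0
      have a2 := hA' b
      obtain ⟨⟨u0, u3⟩, u⟩ := ty j i h.symm 0
      obtain ⟨⟨v0, v3⟩, v⟩ := ty j i h.symm b
      have u2 : S.U j i 0 0 2 = 0 := by omega
      have v2 : S.U j i b b 2 = 0 := by omega
      have hdb : S.d i j b = 2 := by rw [hd i j h]; fin_cases b <;> rfl
      simp [Fin.sum_univ_four, hdb, hd i j h, he, toFn, h0] at h1 h2 h3 h4 q
      generalize S.U i j 0 b 1 = x at *
      generalize S.U i j 0 b 2 = y at *
      generalize S.U i j 0 b 3 = z at *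
      by_contra hz
      have : x = 0 ∧ y = 0 ∧ z = 4 := by omega
      obtain ⟨rfl, rfl, rfl⟩ := this
      simp [u0, a1, u2, u3, v0, a2, v2, v3] at q
    have := S.Ub i j h 0 3
    simp [key, hd i j h, he, toFn] at this
  have n1 := al 0 1 (by decide)
  have n2 := al 2 1 (by decide)
  push Not at n1 n2
  obtain ⟨a, ha⟩ := n1
  obtain ⟨b, hb⟩ := n2
  obtain ⟨⟨u0, u3⟩, u⟩ := ty 0 1 (by decide) a
  obtain ⟨⟨v0, v3⟩, v⟩ := ty 2 1 (by decide) b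
  have u1 : S.U 0 1 a a 1 = 0 := by omega
  have u2 : S.U 0 1 a a 2 = 2 := by omega
  have v1 : S.U 2 1 b b 1 = 0 := by omega
  have v2 : S.U 2 1 b b 2 = 2 := by omega
  have hd2 : ∀ i j, i ≠ j → ∀ a, S.d i j a = 2 := by
    intro i j h a; rw [hd i j h]; fin_cases a <;> rfl
  have q := S.Q1 0 1 2 (by decide) (by decide) (by decide) a b
  have n := S.Nc 0 1 2 (by decide) (by decide) (by decide) a b
  have n0 := S.Nd 0 1 2 (by decide) (by decide) (by decide) a b 0
  have n1 := S.Nd 0 1 2 (by decide) (by decide) (by decide) a b 1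
  have n2 := S.Nd 0 1 2 (by decide) (by decide) (by decide) a b 2
  have n3 := S.Nd 0 1 2 (by decide) (by decide) (by decide) a b 3
  simp [Fin.sum_univ_four, hd2, he, toFn, u0, u1, u2, u3, v0, v1, v2, v3] at q n n0 n1 n2 n3
  generalize S.N 0 1 2 a b 0 = x at *
  generalize S.N 0 1 2 a b 1 = y at *
  generalize S.N 0 1 2 a b 2 = z at *
  generalize S.N 0 1 2 a b 3 = w at *
  obtain ⟨x, rfl⟩ := n0
  obtain ⟨y, rfl⟩ := n1
  obtain ⟨z, rfl⟩ := n2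
  obtain ⟨w, rfl⟩ := n3
  have hx : x ≤ 2 := by omega
  have hy : y ≤ 2 := by omega
  have hz : z ≤ 2 := by omega
  have hw : w = 2 - x - y - z := by omega
  subst hw
  interval_cases x <;> interval_cases y <;> interval_cases z <;> simp at n q

theorem case_10_3 (S : Sys 10 3) : False := by
  rcases S.double cands_10_3 (by decide) (by decide) with ⟨hd, he⟩ | ⟨hd, he⟩
  · have hU : ∀ a, a ≠ 3 → S.U 1 0 a a 0 = 2 ∧ S.U 1 0 a a 1 = 2 ∧ S.U 1 0 a a 2 = 0 ∧
        S.U 1 0 a a 3 = 0 := by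
      intro a ha
      have h0 := S.U0 1 0 (by decide) a a
      have h1 := S.Uk 1 0 (by decide) a a
      have h2 := S.Ud 1 0 (by decide) a a 2
      have h3 := S.Ud 1 0 (by decide) a a 3
      fin_cases a
      rotate_right
      · simp at ha
      all_goals
        simp [Fin.sum_univ_four, hd, he, toFn] at h0 h1 h2 h3 ⊢
        omega
    have q := S.Q2 0 1 (by decide) 0 1
    have h0 := S.U0 0 1 (by decide) 0 1
    have n := S.Uk 0 1 (by decide) 0 1
    have n1 := S.Ud 0 1 (by decide) 0 1 1
    have n2 := S.Ud 0 1 (by decide) 0 1 2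
    have n3 := S.Ud 0 1 (by decide) 0 1 3
    simp [Fin.sum_univ_four, hd, he, toFn, hU] at q n n1 n2 n3 h0
    generalize S.U 0 1 0 1 0 = w at *
    generalize S.U 0 1 0 1 1 = x at *
    generalize S.U 0 1 0 1 2 = y at *
    generalize S.U 0 1 0 1 3 = z at *
    have : (x = 4 ∧ y = 0 ∧ z = 0) ∨ (x = 0 ∧ y = 4 ∧ z = 0) ∨ (x = 0 ∧ y = 0 ∧ z = 4) := by omega
    rcases this with ⟨rfl, rfl, rfl⟩ | ⟨rfl, rfl, rfl⟩ | ⟨rfl, rfl, rfl⟩ <;> simp [h0] at q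
  · have t2 : ∀ i j, i ≠ j → S.U i j 0 0 0 = 2 ∧ S.U i j 0 0 3 = 0 ∧
        ((S.U i j 0 0 1 = 2 ∧ S.U i j 0 0 2 = 0) ∨ (S.U i j 0 0 1 = 0 ∧ S.U i j 0 0 2 = 2)) := by
      intro i j h
      have h0 := S.U0 i j h 0 0
      have h1 := S.Uk i j h 0 0
      have h2 := S.Ud i j h 0 0 1
      have h3 := S.Ud i j h 0 0 2
      have h4 := S.Ud i j h 0 0 3
      simp [Fin.sum_univ_four, hd i j h, he, toFn] at h0 h1 h2 h3 h4 ⊢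
      omega
    have t3 : ∀ i j, i ≠ j → S.U i j 2 2 0 = 3 ∧ S.U i j 2 2 1 = 0 := by
      intro i j h
      have h0 := S.U0 i j h 2 2
      have h1 := S.Uk i j h 2 2
      have h2 := S.Ud i j h 2 2 1
      have h3 := S.Ud i j h 2 2 2
      have h4 := S.Ud i j h 2 2 3
      have h5 := S.Ub i j h 2 1
      simp [Fin.sum_univ_four, hd i j h, he, toFn] at h0 h1 h2 h3 h4 h5 ⊢
      omega
    have tB : ∀ i j k, i ≠ j → j ≠ k → i ≠ k → S.U i j 0 0 1 = 0 ∧ S.U i j 0 0 2 = 2 := by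
      intro i j k hij hjk hik
      obtain ⟨u0, u3, u⟩ := t2 i j hij
      obtain ⟨v0, v1⟩ := t3 k j hjk.symm
      rcases u with ⟨u1, u2⟩ | u
      swap
      · exact u
      exfalso
      have q := S.Q1 i j k hij hjk hik 0 2
      have n := S.Nc i j k hij hjk hik 0 2
      have n0 := S.Nd i j k hij hjk hik 0 2 0
      have n1 := S.Nd i j k hij hjk hik 0 2 1
      have n2 := S.Nd i j k hij hjk hik 0 2 2
      have n3 := S.Nd i j k hij hjk hik 0 2 3
      simp [Fin.sum_univ_four, hd i j hij, hd j k hjk, hd i k hik, he, toFn,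
        u0, u1, u2, u3, v0, v1] at q n n0 n1 n2 n3
      generalize S.N i j k 0 2 0 = x at *
      generalize S.N i j k 0 2 1 = y at *
      generalize S.N i j k 0 2 2 = z at *
      generalize S.N i j k 0 2 3 = w at *
      have : (x = 6 ∧ y = 0 ∧ z = 0 ∧ w = 0) ∨ (x = 0 ∧ y = 6 ∧ z = 0 ∧ w = 0) ∨
        (x = 0 ∧ y = 0 ∧ z = 6 ∧ w = 0) ∨ (x = 0 ∧ y = 0 ∧ z = 0 ∧ w = 6) := by omega
      rcases this with ⟨rfl, rfl, rfl, rfl⟩ | ⟨rfl, rfl, rfl, rfl⟩ | ⟨rfl, rfl, rfl, rfl⟩ |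
        ⟨rfl, rfl, rfl, rfl⟩ <;> simp at q
    obtain ⟨u1, u2⟩ := tB 0 1 2 (by decide) (by decide) (by decide)
    obtain ⟨v1, v2⟩ := tB 2 1 0 (by decide) (by decide) (by decide)
    obtain ⟨u0, u3, -⟩ := t2 0 1 (by decide)
    obtain ⟨v0, v3, -⟩ := t2 2 1 (by decide)
    have q := S.Q1 0 1 2 (by decide) (by decide) (by decide) 0 0
    have n := S.Nc 0 1 2 (by decide) (by decide) (by decide) 0 0
    have n0 := S.Nd 0 1 2 (by decide) (by decide) (by decide) 0 0 0
    have n1 := S.Nd 0 1 2 (by decide) (by decide) (by decide) 0 0 1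
    have n2 := S.Nd 0 1 2 (by decide) (by decide) (by decide) 0 0 2
    have n3 := S.Nd 0 1 2 (by decide) (by decide) (by decide) 0 0 3
    simp [Fin.sum_univ_four, hd, he, toFn, u0, u1, u2, u3, v0, v1, v2, v3] at q n n0 n1 n2 n3
    generalize S.N 0 1 2 0 0 0 = x at *
    generalize S.N 0 1 2 0 0 1 = y at *
    generalize S.N 0 1 2 0 0 2 = z at *
    generalize S.N 0 1 2 0 0 3 = w at *
    have : (x = 4 ∧ y = 0 ∧ z = 0 ∧ w = 0) ∨ (x = 2 ∧ y = 2 ∧ z = 0 ∧ w = 0) ∨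
      (x = 0 ∧ y = 4 ∧ z = 0 ∧ w = 0) := by omega
    rcases this with ⟨rfl, rfl, rfl, rfl⟩ | ⟨rfl, rfl, rfl, rfl⟩ | ⟨rfl, rfl, rfl, rfl⟩ <;>
      simp at q

theorem case_11_3 (S : Sys 11 3) : False := by
  obtain ⟨hd, he⟩ := S.single cands_11_3
  have t2 : ∀ i j, i ≠ j → S.U i j 0 0 0 = 2 ∧ S.U i j 0 0 1 = 2 ∧ S.U i j 0 0 2 = 0 ∧
      S.U i j 0 0 3 = 0 := by
    intro i j h
    have h0 := S.U0 i j h 0 0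
    have h1 := S.Uk i j h 0 0
    have h3 := S.Ud i j h 0 0 2
    have h4 := S.Ud i j h 0 0 3
    simp [Fin.sum_univ_four, hd i j h, he, toFn] at h0 h1 h3 h4 ⊢
    omega
  have t3 : ∀ i j k, i ≠ j → j ≠ k → i ≠ k → ∀ b, b ≠ 0 → S.U k j b b 0 = 3 ∧ S.U k j b b 1 = 3 ∧
      S.U k j b b 2 = 3 ∧ S.U k j b b 3 = 0 := by
    intro i j k hij hjk hik b hb
    obtain ⟨u0, u1, u2, u3⟩ := t2 i j hij
    have hdb : ∀ i j, i ≠ j → S.d i j b = 3 := by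
      intro i j h
      rw [hd i j h]; fin_cases b
      · simp at hb
      all_goals rfl
    have h0 := S.U0 k j hjk.symm b b
    have h1 := S.Uk k j hjk.symm b b
    have h2 := S.Ud k j hjk.symm b b 1
    have h3 := S.Ud k j hjk.symm b b 2
    have h4 := S.Ud k j hjk.symm b b 3
    have h5 : S.U k j b b 1 ≤ 3 := by
      have := S.Ub k j hjk.symm b 1
      have h6 := Finset.single_le_sum (f := fun x => S.U k j b x 1) (fun _ _ => Nat.zero_le _)
        (Finset.mem_univ b)
      simp only [this, hdb k j hjk.symm, he] at h6
      simpa [toFn] using h6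
    have q := S.Q1 i j k hij hjk hik 0 b
    have n := S.Nc i j k hij hjk hik 0 b
    have n0 := S.Nd i j k hij hjk hik 0 b 0
    have n1 := S.Nd i j k hij hjk hik 0 b 1
    have n2 := S.Nd i j k hij hjk hik 0 b 2
    have n3 := S.Nd i j k hij hjk hik 0 b 3
    simp [Fin.sum_univ_four, hdb k j hjk.symm, he, toFn] at h0 h1 h2 h3 h4
    simp [Fin.sum_univ_four, hdb j k hjk, hd i j hij, hd i k hik, he, toFn,
      u0, u1, u2, u3, h0] at q n n0 n1 n2 n3
    generalize S.N i j k 0 b 0 = x at *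
    generalize S.N i j k 0 b 1 = y at *
    generalize S.N i j k 0 b 2 = z at *
    generalize S.N i j k 0 b 3 = w at *
    have : (x = 6 ∧ y = 0 ∧ z = 0 ∧ w = 0) ∨ (x = 0 ∧ y = 6 ∧ z = 0 ∧ w = 0) ∨
      (x = 0 ∧ y = 0 ∧ z = 6 ∧ w = 0) ∨ (x = 0 ∧ y = 0 ∧ z = 0 ∧ w = 6) := by omega
    rcases this with ⟨rfl, rfl, rfl, rfl⟩ | ⟨rfl, rfl, rfl, rfl⟩ | ⟨rfl, rfl, rfl, rfl⟩ |
      ⟨rfl, rfl, rfl, rfl⟩ <;> simp at q <;> omega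
  have q := S.Q2 0 1 (by decide) 1 2
  obtain ⟨a0, a1, a2, a3⟩ := t3 2 0 1 (by decide) (by decide) (by decide) 1 (by decide)
  obtain ⟨b0, b1, b2, b3⟩ := t3 2 0 1 (by decide) (by decide) (by decide) 2 (by decide)
  obtain ⟨c0, c1, c2, c3⟩ := t3 2 1 0 (by decide) (by decide) (by decide) 1 (by decide)
  have h0 := S.U0 0 1 (by decide) 1 2
  have h1 := S.Uk 0 1 (by decide) 1 2
  have h2 := S.Ub 0 1 (by decide) 1 1
  have h3 := S.Ud 0 1 (by decide) 1 2 2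
  have h4 := S.Ud 0 1 (by decide) 1 2 3
  simp [Fin.sum_univ_four, hd, he, toFn, a0, a1, a2, a3, b0, b1, b2, b3] at q h0 h1 h2 h3 h4
  have e1 : S.U 0 1 1 2 1 = 0 := by omega
  generalize S.U 0 1 1 2 2 = x at *
  generalize S.U 0 1 1 2 3 = y at *
  have : (x = 9 ∧ y = 0) ∨ (x = 3 ∧ y = 6) := by omega
  rcases this with ⟨rfl, rfl⟩ | ⟨rfl, rfl⟩ <;> simp [h0, e1] at q

theorem comb5 (P : Fin 5 → Bool) (f g : Fin 5 → Fin 5 → ℕ)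
    (hN : ∀ a b, a ≠ b → P a = false → P b = false → f a b = 2)
    (hg : ∀ a b, P a = P b → g a b = 0)
    (g4 : ∀ a b, g a b ≤ 4)
    (ex : ∃ a, P a = false)
    (sf : ∀ a, ∑ b, f a b = 2) (sg : ∀ a, ∑ b, g a b = 8) (sg' : ∀ b, ∑ a, g a b = 8) : False := by
  obtain ⟨p, hp⟩ := ex
  -- at most one other
  have u : ∀ b c, b ≠ p → c ≠ p → P b = false → P c = false → b = c := by
    intro b c hb hc h1 h2
    by_contra hbc
    have := sf p
    have k : ∑ x ∈ ({b, c} : Finset (Fin 5)), f p x ≤ ∑ x, f p x :=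
      Finset.sum_le_sum_of_subset (Finset.subset_univ _)
    rw [Finset.sum_pair hbc, hN p b (Ne.symm hb) hp h1, hN p c (Ne.symm hc) hp h2] at k
    omega
  -- each A point has value 4 at p
  have v : ∀ a, P a = true → g a p = 4 := by
    intro a ha
    have h8 := sg a
    by_contra hne
    have hlt : g a p < 4 := lt_of_le_of_ne (g4 a p) hne
    have hnp : ∀ x, x ≠ p → P x = true → g a x = 0 := fun x _ h => hg a x (by rw [ha, h])
    by_cases hq : ∃ q, q ≠ p ∧ P q = false
    · obtain ⟨q, hq, hq'⟩ := hq
      have : ∑ x, g a x = ∑ x ∈ ({p, q} : Finset (Fin 5)), g a x := by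
        symm
        apply Finset.sum_subset (Finset.subset_univ _)
        intro x _ hx
        simp only [Finset.mem_insert, Finset.mem_singleton, not_or] at hx
        cases hPx : P x
        · exact absurd (u x q hx.1 hq hPx hq') hx.2
        · exact hnp x hx.1 hPx
      rw [Finset.sum_pair (Ne.symm hq)] at this
      have := g4 a q
      omega
    · push Not at hq
      have : ∑ x, g a x = g a p := by
        apply Finset.sum_eq_single_of_mem _ (Finset.mem_univ _)
        intro x _ hx
        apply hnp x hx
        have := hq x hx
        simpa using this
      omega
  have h8 := sg' p
  have w : ∑ a, g a p = 4 * (Finset.univ.filter (fun a => P a = true)).card := by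
    rw [Finset.card_filter, Finset.mul_sum]
    apply Finset.sum_congr rfl
    intro a _
    cases hPa : P a
    · simp [hg a p (by rw [hPa, hp])]
    · simp [v a hPa]
  have c2 : (Finset.univ.filter (fun a => P a = true)).card = 2 := by omega
  have c3 : (Finset.univ.filter (fun a => ¬ P a = true)).card ≤ 2 := by
    have : ((Finset.univ.filter (fun a => ¬ P a = true)).erase p).card ≤ 1 := by
      rw [Finset.card_le_one]
      intro x hx y hy
      simp at hx hy
      exact u x y hx.1 hy.1 hx.2 hy.2
    have := Finset.pred_card_le_card_erase (s := Finset.univ.filter (fun a => ¬ P a = true)) (a := p)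
    omega
  have := Finset.card_filter_add_card_filter_not (s := (Finset.univ : Finset (Fin 5))) (fun a => P a = true)
  simp only [Finset.card_univ, Fintype.card_fin] at this
  omega

theorem case_10_4 (S : Sys 10 4) : False := by
  obtain ⟨hd, he⟩ := S.single cands_10_4
  have hd2 : ∀ i j, i ≠ j → ∀ a, S.d i j a = 2 := by
    intro i j h a; rw [hd i j h]; fin_cases a <;> rfl
  clear hd
  have ty : ∀ i j, i ≠ j → ∀ a, (S.U i j a a 0 = 2 ∧ S.U i j a a 4 = 0) ∧
      ((S.U i j a a 1 = 2 ∧ S.U i j a a 2 = 0 ∧ S.U i j a a 3 = 0) ∨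
       (S.U i j a a 1 = 0 ∧ S.U i j a a 2 = 2 ∧ S.U i j a a 3 = 0) ∨
       (S.U i j a a 1 = 0 ∧ S.U i j a a 2 = 0 ∧ S.U i j a a 3 = 2)) := by
    intro i j h a
    have h0 := S.U0 i j h a a
    have h1 := S.Uk i j h a a
    have h2 := S.Ud i j h a a 1
    have h3 := S.Ud i j h a a 2
    have h4 := S.Ud i j h a a 3
    have h5 := S.Ud i j h a a 4
    simp [Fin.sum_univ_five, hd2 i j h, he, toFn] at h0 h1 h2 h3 h4 h5 ⊢
    omega
  have off : ∀ i j, i ≠ j → ∀ a b, a ≠ b → ∃ x y z w : ℕ, S.U i j a b 0 = 0 ∧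
      S.U i j a b 1 = 2 * x ∧ S.U i j a b 2 = 2 * y ∧ S.U i j a b 3 = 2 * z ∧
      S.U i j a b 4 = 4 * w ∧ x ≤ 1 ∧ x + y + z + 2 * w = 2 := by
    intro i j h a b hab
    have h0 := S.U0 i j h a b
    have h1 := S.Uk i j h a b
    have h2 := S.Ud i j h a b 1
    have h3 := S.Ud i j h a b 2
    have h4 := S.Ud i j h a b 3
    have h5 := S.Ud i j h a b 4
    have h6 := S.Ub i j h a 1
    have h7 := Finset.single_le_sum (f := fun x => S.U i j a x 1) (fun _ _ => Nat.zero_le _)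
        (Finset.mem_univ b)
    rw [h6] at h7
    simp [Fin.sum_univ_five, hd2 i j h, he, toFn, hab] at h0 h1 h2 h3 h4 h5 h7
    obtain ⟨x, hx⟩ := h2
    obtain ⟨y, hy⟩ := h3
    obtain ⟨z, hz⟩ := h4
    obtain ⟨-, w, hw⟩ := h5
    exact ⟨x, y, z, w, h0, hx, hy, hz, hw, by omega, by omega⟩
  have L0 : ∀ i j, i ≠ j → ∀ a, S.U i j a a 1 = 2 → S.U j i a a 1 = 2 := by
    intro i j h a hA
    have q := S.Q2 i j h a a
    obtain ⟨⟨u0, u4⟩, ⟨u1, u2, u3⟩ | ⟨u1, u2, u3⟩ | ⟨u1, u2, u3⟩⟩ := ty i j h a <;>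
    obtain ⟨⟨v0, v4⟩, ⟨v1, v2, v3⟩ | ⟨v1, v2, v3⟩ | ⟨v1, v2, v3⟩⟩ := ty j i h.symm a <;>
    first
    | exact v1
    | (exfalso; omega)
    | (exfalso; simp [Fin.sum_univ_five, he, toFn, u0, u1, u2, u3, u4, v0, v1, v2, v3, v4] at q)
  have AA : ∀ i j, i ≠ j → ∀ a b, S.U j i a a 1 = 2 → S.U j i b b 1 = 2 → S.U i j a b 4 = 0 := by
    intro i j h a b ha hb
    by_cases hab : a = b
    · subst hab; exact (ty i j h a).1.2
    have q := S.Q2 i j h a b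
    obtain ⟨x, y, z, w, h0, h1, h2, h3, h4, hx, hs⟩ := off i j h a b hab
    obtain ⟨⟨u0, u4⟩, u⟩ := ty j i h.symm a
    obtain ⟨⟨v0, v4⟩, v⟩ := ty j i h.symm b
    have u2 : S.U j i a a 2 = 0 ∧ S.U j i a a 3 = 0 := by omega
    have v2 : S.U j i b b 2 = 0 ∧ S.U j i b b 3 = 0 := by omega
    simp [Fin.sum_univ_five, he, toFn, u0, ha, u2, u4, v0, hb, v2, v4, h0, h1, h2, h3, h4] at q
    have hw : w ≤ 1 := by omega
    interval_cases w
    · simp [h4]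
    · have : x = 0 ∧ y = 0 ∧ z = 0 := by omega
      obtain ⟨rfl, rfl, rfl⟩ := this
      simp at q
  have L1 : ∀ i j, i ≠ j → ∃ a, S.U i j a a 1 = 0 := by
    intro i j h
    by_contra hc
    push Not at hc
    have hA : ∀ a, S.U j i a a 1 = 2 := by
      intro a
      apply L0 i j h a
      have := hc a
      obtain ⟨_, u⟩ := ty i j h a
      omega
    have := S.Ub i j h 0 4
    simp [AA i j h _ _ (hA _) (hA _), hd2 i j h, he, toFn] at this
  have L2 : ∀ i j k, i ≠ j → j ≠ k → i ≠ k → ∀ a b, S.U i j a a 1 = 0 → S.U k j b b 1 = 0 →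
      S.U i j a a 2 ≠ S.U k j b b 2 := by
    intro i j k hij hjk hik a b ha hb hab
    have q := S.Q1 i j k hij hjk hik a b
    have n := S.Nc i j k hij hjk hik a b
    have n0 := S.Nd i j k hij hjk hik a b 0
    have n1 := S.Nd i j k hij hjk hik a b 1
    have n2 := S.Nd i j k hij hjk hik a b 2
    have n3 := S.Nd i j k hij hjk hik a b 3
    have n4 := S.Nd i j k hij hjk hik a b 4
    have rhs : ∑ x, S.U i j a a x * S.U k j b b x / S.e j x = 6 := by
      obtain ⟨⟨u0, u4⟩, ⟨u1, u2, u3⟩ | ⟨u1, u2, u3⟩ | ⟨u1, u2, u3⟩⟩ := ty i j hij a <;>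
      obtain ⟨⟨v0, v4⟩, ⟨v1, v2, v3⟩ | ⟨v1, v2, v3⟩ | ⟨v1, v2, v3⟩⟩ := ty k j hjk.symm b <;>
      first
      | (exfalso; omega)
      | simp [Fin.sum_univ_five, he, toFn, u0, u1, u2, u3, u4, v0, v1, v2, v3, v4]
    rw [rhs] at q
    simp [Fin.sum_univ_five, hd2 i j hij, hd2 j k hjk, hd2 i k hik] at q n n0 n1 n2 n3 n4
    generalize S.N i j k a b 0 = x at *
    generalize S.N i j k a b 1 = y at *
    generalize S.N i j k a b 2 = z at *
    generalize S.N i j k a b 3 = w at *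
    generalize S.N i j k a b 4 = t at *
    obtain ⟨x, rfl⟩ := n0
    obtain ⟨y, rfl⟩ := n1
    obtain ⟨z, rfl⟩ := n2
    obtain ⟨w, rfl⟩ := n3
    obtain ⟨t, rfl⟩ := n4
    have e : ∀ x : ℕ, 2 * x * (2 * x) / 2 = 2 * (x * x) := by
      intro x
      rw [show 2 * x * (2 * x) = 2 * (2 * (x * x)) by ring]
      exact Nat.mul_div_cancel_left _ (by norm_num)
    rw [e, e, e, e, e] at q
    have sq : ∀ x : ℕ, x ≤ 2 → (x = 0 ∧ x * x = 0) ∨ (x = 1 ∧ x * x = 1) ∨ (x = 2 ∧ x * x = 4) := by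
      intro x hx; interval_cases x <;> simp
    have := sq x (by omega)
    have := sq y (by omega)
    have := sq z (by omega)
    have := sq w (by omega)
    have := sq t (by omega)
    omega
  obtain ⟨b0, hb0⟩ := L1 2 0 (by decide)
  have L3 : ∀ a b, S.U 1 0 a a 1 = 0 → S.U 1 0 b b 1 = 0 → S.U 1 0 a a 2 = S.U 1 0 b b 2 := by
    intro a b ha hb
    have h1 := L2 1 0 2 (by decide) (by decide) (by decide) a b0 ha hb0
    have h2 := L2 1 0 2 (by decide) (by decide) (by decide) b b0 hb hb0
    obtain ⟨_, u⟩ := ty 1 0 (by decide) a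
    obtain ⟨_, v⟩ := ty 1 0 (by decide) b
    obtain ⟨_, w⟩ := ty 2 0 (by decide) b0
    omega
  have L4 : ∀ a b, a ≠ b → S.U 1 0 a a 1 = 0 → S.U 1 0 b b 1 = 0 →
      S.U 0 1 a b 1 = 2 ∧ S.U 0 1 a b 4 = 0 := by
    intro a b hab ha hb
    have q := S.Q2 0 1 (by decide) a b
    have h23 := L3 a b ha hb
    obtain ⟨x, y, z, w, h0, h1, h2, h3, h4, hx, hs⟩ := off 0 1 (by decide) a b hab
    have rhs : ∑ x, S.U 1 0 a a x * S.U 1 0 b b x / S.e 0 x = 6 := by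
      obtain ⟨⟨u0, u4⟩, ⟨u1, u2, u3⟩ | ⟨u1, u2, u3⟩ | ⟨u1, u2, u3⟩⟩ := ty 1 0 (by decide) a <;>
      obtain ⟨⟨v0, v4⟩, ⟨v1, v2, v3⟩ | ⟨v1, v2, v3⟩ | ⟨v1, v2, v3⟩⟩ := ty 1 0 (by decide) b <;>
      first
      | (exfalso; omega)
      | simp [Fin.sum_univ_five, he, toFn, u0, u1, u2, u3, u4, v0, v1, v2, v3, v4]
    rw [rhs] at q
    simp [Fin.sum_univ_five, he, toFn, h0, h1, h2, h3, h4] at q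
    have : (x = 1 ∧ w = 0) ∨ (x = 0 ∧ y = 0 ∧ z = 0 ∧ w = 1) ∨ (x = 0 ∧ y = 1 ∧ z = 1 ∧ w = 0) ∨
      (x = 0 ∧ y = 2 ∧ z = 0 ∧ w = 0) ∨ (x = 0 ∧ y = 0 ∧ z = 2 ∧ w = 0) := by omega
    rcases this with ⟨rfl, rfl⟩ | ⟨rfl, rfl, rfl, rfl⟩ | ⟨rfl, rfl, rfl, rfl⟩ |
      ⟨rfl, rfl, rfl, rfl⟩ | ⟨rfl, rfl, rfl, rfl⟩
    · exact ⟨by omega, by omega⟩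
    all_goals simp at q
  have dich : ∀ a, S.U 1 0 a a 1 = 0 ∨ S.U 1 0 a a 1 = 2 := by
    intro a
    obtain ⟨_, u⟩ := ty 1 0 (by decide) a
    omega
  refine comb5 (fun a => decide (S.U 1 0 a a 1 = 2)) (fun a b => S.U 0 1 a b 1)
    (fun a b => S.U 0 1 a b 4) ?_ ?_ ?_ ?_ ?_ ?_ ?_
  · intro a b hab ha hb
    simp only [decide_eq_false_iff_not] at ha hb
    exact (L4 a b hab ((dich a).resolve_right ha) ((dich b).resolve_right hb)).1
  · intro a b hab
    by_cases e : a = b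
    · subst e; exact (ty 0 1 (by decide) a).1.2
    rcases dich a with ha | ha <;> rcases dich b with hb | hb
    · exact (L4 a b e ha hb).2
    · simp [ha, hb] at hab
    · simp [ha, hb] at hab
    · exact AA 0 1 (by decide) a b ha hb
  · intro a b
    by_cases e : a = b
    · subst e
      have := (ty 0 1 (by decide) a).1.2
      show S.U 0 1 a a 4 ≤ 4
      omega
    obtain ⟨x, y, z, w, h0, h1, h2, h3, h4, hx, hs⟩ := off 0 1 (by decide) a b e
    show S.U 0 1 a b 4 ≤ 4
    omega
  · obtain ⟨a, ha⟩ := L1 1 0 (by decide)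
    exact ⟨a, by simp [ha]⟩
  · intro a
    have := S.Ub 0 1 (by decide) a 1
    simpa [hd2, he, toFn] using this
  · intro a
    have := S.Ub 0 1 (by decide) a 4
    simpa [hd2, he, toFn] using this
  · intro a
    have := S.Ua 0 1 (by decide) a 4
    simpa [hd2, he, toFn] using this

theorem false_of_le (S : Sys m s) (hm : m ≤ 11) : False := by
  have h1 := S.ds 0 1 (by decide)
  have h2 : ∑ a : Fin (s+1), 2 ≤ ∑ a, S.d 0 1 a :=
    Finset.sum_le_sum (fun a _ => S.d2 0 1 (by decide) a)
  simp at h2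
  have hs : s ≤ 4 := by omega
  have nn := S.ne_nil
  interval_cases s
  · have := S.es 0
    have h3 := S.e0 0
    simp at this
    omega
  · by_cases h7 : m = 7
    · subst h7; exact S.case_7_1
    by_cases h8 : m = 11
    · subst h8; exact S.case_11_1
    exact nn (cands_s1 m (by omega) h7 h8)
  · by_cases h7 : m = 6
    · subst h7; exact S.case_6_2
    by_cases h8 : m = 8
    · subst h8; exact S.case_8_2
    by_cases h9 : m = 10
    · subst h9; exact S.case_10_2
    by_cases h10 : m = 11
    · subst h10; exact S.case_11_2
    exact nn (cands_s2 m (by omega) h7 h8 h9 h10)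
  · by_cases h7 : m = 8
    · subst h7; exact S.case_8_3
    by_cases h9 : m = 10
    · subst h9; exact S.case_10_3
    by_cases h10 : m = 11
    · subst h10; exact S.case_11_3
    exact nn (cands_s3 m (by omega) h7 h9 h10)
  · by_cases h9 : m = 10
    · subst h9; exact S.case_10_4
    exact nn (cands_s4 m (by omega) h9)

end Sys

section SchemePart

set_option linter.unusedSectionVars false

variable [Fintype V]

noncomputable def chi (R : Set (V × V)) (x y : V) : ℕ := if (x, y) ∈ R then 1 else 0

theorem chi_transp (R : Set (V × V)) (x y : V) : chi (transp R) x y = chi R y x := rfl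

theorem card_eq_sum (p : V → Prop) : Nat.card {w : V | p w} = ∑ w, if p w then 1 else 0 := by
  rw [Finset.sum_boole, Nat.card_eq_fintype_card, Fintype.card_subtype]
  simp

theorem iNum_eq_s5 (R S : Set (V × V)) (p : V × V) :
    iNum R S p = ∑ w, chi R p.1 w * chi S w p.2 := by
  unfold iNum chi
  rw [card_eq_sum]
  apply Finset.sum_congr rfl
  intro w _
  by_cases h1 : (p.1, w) ∈ R <;> by_cases h2 : (w, p.2) ∈ S <;> simp [h1, h2]

theorem chi_sq (R : Set (V × V)) (x y : V) : chi R x y * chi R x y = chi R x y := by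
  unfold chi; split_ifs <;> simp

theorem transp_transp (R : Set (V × V)) : transp (transp R) = R := rfl

variable {ℛ : Set (Set (V × V))} {m : ℕ}

def Fb (ℛ : Set (Set (V × V))) (m : ℕ) (X : Set V) : Prop := IsFiber ℛ X ∧ Nat.card X = m

theorem transp_mem (hC : IsCC ℛ) {X Y : Set V} {R : Set (V × V)} (hR : R ∈ relsBtw ℛ X Y) :
    transp R ∈ relsBtw ℛ Y X :=
  ⟨hC.2.2.2.1 R hR.1, fun p hp => by
    have := hR.2 (show p.swap ∈ R from hp)
    exact ⟨this.2, this.1⟩⟩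

theorem Fb.pos {X : Set V} (hX : Fb ℛ m X) : 0 < m := by
  rw [← hX.2]
  have := hX.1.1.to_subtype
  exact Nat.card_pos

theorem out_eq (hC : IsCC ℛ) {X Y : Set V} (hX : Fb ℛ m X) {R : Set (V × V)}
    (hR : R ∈ relsBtw ℛ X Y) (x : V) (hx : x ∈ X) : ∑ y, chi R x y = outDeg R := by
  have hne := hC.1 R hR.1
  unfold outDeg
  rw [dif_pos hne, card_eq_sum]
  have hc := (hR.2 hne.choose_spec).1
  have key := hC.2.2.2.2 R hR.1 (transp R) (hC.2.2.2.1 R hR.1) (diag X) hX.1.2 (x, x) ⟨hx, rfl⟩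
    (hne.choose.1, hne.choose.1) ⟨hc, rfl⟩
  rw [iNum_eq_s5, iNum_eq_s5] at key
  simp only [chi_transp, chi_sq] at key
  exact key

theorem in_eq0 (hC : IsCC ℛ) {X Y : Set V} (hY : Fb ℛ m Y) {R : Set (V × V)}
    (hR : R ∈ relsBtw ℛ X Y) (y : V) (hy : y ∈ Y) : ∑ x, chi R x y = inDeg R := by
  have hne := hC.1 R hR.1
  unfold inDeg
  rw [dif_pos hne, card_eq_sum]
  have hc := (hR.2 hne.choose_spec).2
  have key := hC.2.2.2.2 (transp R) (hC.2.2.2.1 R hR.1) R hR.1 (diag Y) hY.1.2 (y, y) ⟨hy, rfl⟩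
    (hne.choose.2, hne.choose.2) ⟨hc, rfl⟩
  rw [iNum_eq_s5, iNum_eq_s5] at key
  simp only [chi_transp, chi_sq] at key
  exact key

theorem chi_zero_left {X Y : Set V} {R : Set (V × V)} (hR : R ∈ relsBtw ℛ X Y) {x y : V}
    (hx : x ∉ X) : chi R x y = 0 := by
  unfold chi; rw [if_neg]; exact fun h => hx (hR.2 h).1

theorem chi_zero_right {X Y : Set V} {R : Set (V × V)} (hR : R ∈ relsBtw ℛ X Y) {x y : V}
    (hy : y ∉ Y) : chi R x y = 0 := by
  unfold chi; rw [if_neg]; exact fun h => hy (hR.2 h).2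

theorem sum_fiber {X : Set V} (hX : Fb ℛ m X) (k : ℕ) : ∑ x, (if x ∈ X then k else 0) = m * k := by
  have := card_eq_sum (fun x => x ∈ X)
  have h2 : Nat.card {w : V | w ∈ X} = m := hX.2
  rw [h2] at this
  rw [this, Finset.sum_mul]
  apply Finset.sum_congr rfl
  intro x _
  split_ifs <;> simp

theorem edges_out (hC : IsCC ℛ) {X Y : Set V} (hX : Fb ℛ m X) {R : Set (V × V)}
    (hR : R ∈ relsBtw ℛ X Y) : ∑ x, ∑ y, chi R x y = m * outDeg R := by
  rw [← sum_fiber hX]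
  apply Finset.sum_congr rfl
  intro x _
  split_ifs with h
  · exact out_eq hC hX hR x h
  · exact Finset.sum_eq_zero (fun y _ => chi_zero_left hR h)

theorem edges_in (hC : IsCC ℛ) {X Y : Set V} (hY : Fb ℛ m Y) {R : Set (V × V)}
    (hR : R ∈ relsBtw ℛ X Y) : ∑ x, ∑ y, chi R x y = m * inDeg R := by
  rw [← sum_fiber hY, Finset.sum_comm]
  apply Finset.sum_congr rfl
  intro x _
  split_ifs with h
  · exact in_eq0 hC hY hR x h
  · exact Finset.sum_eq_zero (fun y _ => chi_zero_right hR h)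

theorem in_out (hC : IsCC ℛ) {X Y : Set V} (hX : Fb ℛ m X) (hY : Fb ℛ m Y) {R : Set (V × V)}
    (hR : R ∈ relsBtw ℛ X Y) : inDeg R = outDeg R := by
  have := (edges_in hC hY hR).symm.trans (edges_out hC hX hR)
  exact Nat.eq_of_mul_eq_mul_left hX.pos this

theorem out_transp (hC : IsCC ℛ) {X Y : Set V} (hX : Fb ℛ m X) (hY : Fb ℛ m Y) {R : Set (V × V)}
    (hR : R ∈ relsBtw ℛ X Y) : outDeg (transp R) = outDeg R := by
  have h1 := edges_out hC hY (transp_mem hC hR)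
  have h2 := edges_out hC hX hR
  simp only [chi_transp] at h1
  rw [Finset.sum_comm, h2] at h1
  exact (Nat.eq_of_mul_eq_mul_left hX.pos h1).symm

theorem out_pos (hC : IsCC ℛ) {X Y : Set V} (hX : Fb ℛ m X) {R : Set (V × V)}
    (hR : R ∈ relsBtw ℛ X Y) : 1 ≤ outDeg R := by
  obtain ⟨⟨x, y⟩, hp⟩ := hC.1 R hR.1
  rw [← out_eq hC hX hR x (hR.2 hp).1]
  have h := Finset.single_le_sum (f := fun y => chi R x y) (fun _ _ => Nat.zero_le _)
    (Finset.mem_univ y)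
  simp only [chi, if_pos hp] at h ⊢
  exact h

noncomputable def NN (R S T : Set (V × V)) : ℕ := outDeg T * sConst R S T

theorem sConst_eq (hC : IsCC ℛ) {R S T : Set (V × V)} (hR : R ∈ ℛ) (hS : S ∈ ℛ) (hT : T ∈ ℛ)
    (x z : V) : (∑ y, chi R x y * chi S y z) * chi T x z = sConst R S T * chi T x z := by
  by_cases h : (x, z) ∈ T
  · have hne := hC.1 T hT
    unfold sConst
    rw [dif_pos hne, ← hC.2.2.2.2 R hR S hS T hT (x, z) h _ hne.choose_spec, iNum_eq_s5]
  · simp [chi, h]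

noncomputable def tri (R S T : Set (V × V)) : ℕ := ∑ x, ∑ y, ∑ z, chi R x y * chi S y z * chi T x z

theorem tri_eq (hC : IsCC ℛ) {X Z : Set V} (hX : Fb ℛ m X) {R S T : Set (V × V)}
    (hR : R ∈ ℛ) (hS : S ∈ ℛ) (hT : T ∈ relsBtw ℛ X Z) : tri R S T = m * NN R S T := by
  unfold tri NN
  rw [← mul_assoc, ← edges_out hC hX hT, Finset.sum_mul]
  apply Finset.sum_congr rfl
  intro x _
  rw [Finset.sum_comm, Finset.sum_mul]
  apply Finset.sum_congr rfl
  intro z _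
  rw [← Finset.sum_mul, sConst_eq hC hR hS hT.1, mul_comm]

theorem tri_symm1 (R S T : Set (V × V)) : tri R S T = tri T (transp S) R := by
  unfold tri
  apply Finset.sum_congr rfl
  intro x _
  rw [Finset.sum_comm]
  refine Finset.sum_congr rfl fun z _ => Finset.sum_congr rfl fun y _ => ?_
  rw [chi_transp]; ring

theorem tri_symm2 (R S T : Set (V × V)) : tri R S T = tri (transp R) T S := by
  unfold tri
  rw [Finset.sum_comm]
  refine Finset.sum_congr rfl fun y _ => Finset.sum_congr rfl fun x _ =>
    Finset.sum_congr rfl fun z _ => ?_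
  rw [chi_transp]; ring

section Triple
variable {X Y Z : Set V} {R S T : Set (V × V)}

theorem NN_symm1 (hC : IsCC ℛ) (hX : Fb ℛ m X)
    (hR : R ∈ relsBtw ℛ X Y) (hS : S ∈ relsBtw ℛ Y Z) (hT : T ∈ relsBtw ℛ X Z) :
    NN R S T = NN T (transp S) R := by
  have h := tri_symm1 R S T
  rw [tri_eq hC hX hR.1 hS.1 hT, tri_eq hC hX hT.1 (transp_mem hC hS).1 hR] at h
  exact Nat.eq_of_mul_eq_mul_left hX.pos h

theorem NN_symm2 (hC : IsCC ℛ) (hX : Fb ℛ m X) (hY : Fb ℛ m Y)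
    (hR : R ∈ relsBtw ℛ X Y) (hS : S ∈ relsBtw ℛ Y Z) (hT : T ∈ relsBtw ℛ X Z) :
    NN R S T = NN (transp R) T S := by
  have h := tri_symm2 R S T
  rw [tri_eq hC hX hR.1 hS.1 hT, tri_eq hC hY (transp_mem hC hR).1 hT.1 hS] at h
  exact Nat.eq_of_mul_eq_mul_left hX.pos h

theorem NN_dvd (hC : IsCC ℛ) (hX : Fb ℛ m X) (hY : Fb ℛ m Y)
    (hR : R ∈ relsBtw ℛ X Y) (hS : S ∈ relsBtw ℛ Y Z) (hT : T ∈ relsBtw ℛ X Z) :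
    outDeg R ∣ NN R S T ∧ outDeg S ∣ NN R S T ∧ outDeg T ∣ NN R S T := by
  refine ⟨?_, ?_, Dvd.intro _ rfl⟩
  · rw [NN_symm1 hC hX hR hS hT]; exact Dvd.intro _ rfl
  · rw [NN_symm2 hC hX hY hR hS hT]; exact Dvd.intro _ rfl

end Triple

/-- an enumeration of the relations between two fibers -/
structure Enm (ℛ : Set (Set (V × V))) (X Y : Set V) (s : ℕ) (ρ : Fin (s+1) → Set (V × V)) : Prop where
  inj : Function.Injective ρ
  mem : ∀ a, ρ a ∈ relsBtw ℛ X Y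
  surj : ∀ R ∈ relsBtw ℛ X Y, ∃ a, ρ a = R

theorem rel_exists (hC : IsCC ℛ) {X Y : Set V} (hX : Fb ℛ m X) (hY : Fb ℛ m Y) {x y : V} (hx : x ∈ X)
    (hy : y ∈ Y) : ∃ R ∈ relsBtw ℛ X Y, (x, y) ∈ R := by
  obtain ⟨R, ⟨hR, hp⟩, -⟩ := hC.2.1 (x, y)
  refine ⟨R, ⟨hR, ?_⟩, hp⟩
  rintro ⟨u, v⟩ huv
  have h1 := hC.2.2.2.2 (diag X) hX.1.2 R hR R hR (x, y) hp (u, v) huv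
  have h2 := hC.2.2.2.2 R hR (diag Y) hY.1.2 R hR (x, y) hp (u, v) huv
  rw [iNum_eq_s5, iNum_eq_s5] at h1 h2
  constructor
  · by_contra hu
    have e : ∑ w, chi (diag X) u w * chi R w v = 0 := by
      apply Finset.sum_eq_zero
      intro w _
      have : chi (diag X) u w = 0 := by
        unfold chi; rw [if_neg]; exact fun h => hu h.1
      simp [this]
    simp only [e] at h1
    have := (Finset.sum_eq_zero_iff.1 h1) x (Finset.mem_univ _)
    simp [chi, hp, diag] at this
    exact this hx
  · by_contra hu
    have e : ∑ w, chi R u w * chi (diag Y) w v = 0 := by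
      apply Finset.sum_eq_zero
      intro w _
      have : chi (diag Y) w v = 0 := by
        unfold chi; rw [if_neg]; rintro ⟨h, h'⟩
        simp only at h h'
        subst h'; exact hu h
      simp [this]
    simp only [e] at h2
    have := (Finset.sum_eq_zero_iff.1 h2) y (Finset.mem_univ _)
    simp [chi, hp, diag] at this
    exact this hy

theorem Enm.sum_one (hC : IsCC ℛ) {X Y : Set V} (hX : Fb ℛ m X) (hY : Fb ℛ m Y) {s : ℕ}
    {ρ : Fin (s+1) → Set (V × V)} (h : Enm ℛ X Y s ρ) {x y : V} (hx : x ∈ X) (hy : y ∈ Y) :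
    ∃ a, ∀ b, chi (ρ b) x y = if b = a then 1 else 0 := by
  obtain ⟨R, hR, hp⟩ := rel_exists hC hX hY hx hy
  obtain ⟨a, rfl⟩ := h.surj R hR
  refine ⟨a, fun b => ?_⟩
  unfold chi
  by_cases hb : b = a
  · subst hb; simp [hp]
  · rw [if_neg, if_neg hb]
    intro hp'
    exact hb (h.inj ((hC.2.1 (x, y)).unique ⟨(h.mem b).1, hp'⟩ ⟨(h.mem a).1, hp⟩))

theorem Enm.sum_one' (hC : IsCC ℛ) {X Y : Set V} (hX : Fb ℛ m X) (hY : Fb ℛ m Y) {s : ℕ}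
    {ρ : Fin (s+1) → Set (V × V)} (h : Enm ℛ X Y s ρ) {x y : V} (hx : x ∈ X) (hy : y ∈ Y) :
    ∑ b, chi (ρ b) x y = 1 := by
  obtain ⟨a, ha⟩ := h.sum_one hC hX hY hx hy
  simp [ha]

theorem Enm.sum_deg (hC : IsCC ℛ) {X Y : Set V} (hX : Fb ℛ m X) (hY : Fb ℛ m Y) {s : ℕ}
    {ρ : Fin (s+1) → Set (V × V)} (h : Enm ℛ X Y s ρ) : ∑ a, outDeg (ρ a) = m := by
  obtain ⟨x, hx⟩ := hX.1.1
  rw [Finset.sum_congr rfl (fun a _ => (out_eq hC hX (h.mem a) x hx).symm), Finset.sum_comm]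
  rw [← mul_one m, ← sum_fiber hY]
  apply Finset.sum_congr rfl
  intro y _
  split_ifs with hy
  · exact h.sum_one' hC hX hY hx hy
  · exact Finset.sum_eq_zero (fun a _ => chi_zero_right (h.mem a) hy)

theorem marg3 (hC : IsCC ℛ) {X Y Z : Set V} (hX : Fb ℛ m X) (hY : Fb ℛ m Y) (hZ : Fb ℛ m Z) {s : ℕ}
    {R S : Set (V × V)} (hR : R ∈ relsBtw ℛ X Y) (hS : S ∈ relsBtw ℛ Y Z)
    {ρ : Fin (s+1) → Set (V × V)} (h : Enm ℛ X Z s ρ) :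
    ∑ c, NN R S (ρ c) = outDeg R * outDeg S := by
  apply Nat.eq_of_mul_eq_mul_left hX.pos
  rw [Finset.mul_sum, Finset.sum_congr rfl (fun c _ => (tri_eq hC hX hR.1 hS.1 (h.mem c)).symm)]
  unfold tri
  rw [← mul_assoc, ← edges_out hC hX hR, Finset.sum_comm, Finset.sum_mul]
  apply Finset.sum_congr rfl
  intro x _
  rw [Finset.sum_comm, Finset.sum_mul]
  apply Finset.sum_congr rfl
  intro y _
  rw [Finset.sum_comm]
  by_cases hx : x ∈ X
  swap
  · simp [chi_zero_left hR hx]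
  by_cases hy : y ∈ Y
  swap
  · simp [chi_zero_right hR hy]
  rw [← out_eq hC hY hS y hy, Finset.mul_sum]
  apply Finset.sum_congr rfl
  intro z _
  rw [← Finset.mul_sum]
  by_cases hz : z ∈ Z
  · rw [h.sum_one' hC hX hZ hx hz, mul_one]
  · simp [chi_zero_right hS hz]

theorem marg2 (hC : IsCC ℛ) {X Y Z : Set V} (hX : Fb ℛ m X) (hY : Fb ℛ m Y) (hZ : Fb ℛ m Z) {s : ℕ}
    {R T : Set (V × V)} (hR : R ∈ relsBtw ℛ X Y) (hT : T ∈ relsBtw ℛ X Z)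
    {ρ : Fin (s+1) → Set (V × V)} (h : Enm ℛ Y Z s ρ) :
    ∑ c, NN R (ρ c) T = outDeg R * outDeg T := by
  rw [Finset.sum_congr rfl (fun c _ => NN_symm2 hC hX hY hR (h.mem c) hT),
    marg3 hC hY hX hZ (transp_mem hC hR) hT h, out_transp hC hX hY hR]

theorem marg1 (hC : IsCC ℛ) {X Y Z : Set V} (hX : Fb ℛ m X) (hY : Fb ℛ m Y) (hZ : Fb ℛ m Z) {s : ℕ}
    {S T : Set (V × V)} (hS : S ∈ relsBtw ℛ Y Z) (hT : T ∈ relsBtw ℛ X Z)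
    {ρ : Fin (s+1) → Set (V × V)} (h : Enm ℛ X Y s ρ) :
    ∑ c, NN (ρ c) S T = outDeg S * outDeg T := by
  rw [Finset.sum_congr rfl (fun c _ => NN_symm1 hC hX (h.mem c) hS hT),
    marg3 hC hX hZ hY hT (transp_mem hC hS) h, out_transp hC hY hZ hS, mul_comm]

theorem NN_diag (hC : IsCC ℛ) {X Y : Set V} (hX : Fb ℛ m X) (hY : Fb ℛ m Y)
    {R S : Set (V × V)} (hR : R ∈ relsBtw ℛ X Y) (hS : S ∈ relsBtw ℛ X Y) :
    NN (transp R) S (diag Y) = if R = S then outDeg R else 0 := by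
  apply Nat.eq_of_mul_eq_mul_left hX.pos
  rw [← tri_eq hC hY (transp_mem hC hR).1 hS.1 (Z := Y)
    ⟨hY.1.2, fun p hp => ⟨hp.1, by rw [← hp.2]; exact hp.1⟩⟩]
  have e : tri (transp R) S (diag Y) = ∑ x, ∑ y, chi R x y * chi S x y := by
    unfold tri
    rw [Finset.sum_comm]
    refine Finset.sum_congr rfl fun x _ => Finset.sum_congr rfl fun y _ => ?_
    rw [Finset.sum_eq_single_of_mem y (Finset.mem_univ _)]
    · by_cases hy : y ∈ Y
      · rw [chi_transp]; simp [chi, diag, hy]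
      · simp [chi_transp, chi_zero_right hR hy]
    · intro z _ hz
      have : chi (diag Y) y z = 0 := by
        unfold chi; rw [if_neg]; exact fun h => hz h.2.symm
      simp [this]
  rw [e]
  split_ifs with h
  · subst h
    rw [← edges_out hC hX hR]
    simp [chi_sq]
  · rw [mul_zero]
    refine Finset.sum_eq_zero fun x _ => Finset.sum_eq_zero fun y _ => ?_
    unfold chi
    by_cases h1 : (x, y) ∈ R
    · by_cases h2 : (x, y) ∈ S
      · exact absurd ((hC.2.1 (x, y)).unique ⟨hR.1, h1⟩ ⟨hS.1, h2⟩) h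
      · simp [h2]
    · simp [h1]

theorem half (hC : IsCC ℛ) {X Y W Z : Set V} (hX : Fb ℛ m X) (hZ : Fb ℛ m Z) {s : ℕ}
    {R S R' S' : Set (V × V)} (hR : R ∈ relsBtw ℛ X Y) (hS : S ∈ relsBtw ℛ Y Z)
    (hR' : R' ∈ relsBtw ℛ X W) (hS' : S' ∈ relsBtw ℛ W Z)
    {ρ : Fin (s+1) → Set (V × V)} (h : Enm ℛ X Z s ρ) :
    m * ∑ c, NN R S (ρ c) * NN R' S' (ρ c) / outDeg (ρ c) =
      ∑ x, ∑ z, (∑ y, chi R x y * chi S y z) * (∑ w, chi R' x w * chi S' w z) := by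
  have e : ∀ c, NN R S (ρ c) * NN R' S' (ρ c) / outDeg (ρ c) =
      outDeg (ρ c) * (sConst R S (ρ c) * sConst R' S' (ρ c)) := by
    intro c
    unfold NN
    rw [show outDeg (ρ c) * sConst R S (ρ c) * (outDeg (ρ c) * sConst R' S' (ρ c)) =
      outDeg (ρ c) * (outDeg (ρ c) * (sConst R S (ρ c) * sConst R' S' (ρ c))) by ring]
    exact Nat.mul_div_cancel_left _ (out_pos hC hX (h.mem c))
  simp only [e]
  rw [Finset.mul_sum]
  have e2 : ∀ c, m * (outDeg (ρ c) * (sConst R S (ρ c) * sConst R' S' (ρ c))) =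
      ∑ x, ∑ z, chi (ρ c) x z * ((∑ y, chi R x y * chi S y z) * (∑ w, chi R' x w * chi S' w z)) := by
    intro c
    rw [← mul_assoc, ← edges_out hC hX (h.mem c), Finset.sum_mul]
    refine Finset.sum_congr rfl fun x _ => ?_
    rw [Finset.sum_mul]
    refine Finset.sum_congr rfl fun z _ => ?_
    have h1 := sConst_eq hC hR.1 hS.1 (h.mem c).1 x z
    have h2 := sConst_eq hC hR'.1 hS'.1 (h.mem c).1 x z
    by_cases hp : (x, z) ∈ ρ c
    · simp only [chi, if_pos hp, mul_one, one_mul] at h1 h2 ⊢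
      rw [h1, h2]
    · simp [chi, hp]
  simp only [e2]
  rw [Finset.sum_comm]
  refine Finset.sum_congr rfl fun x _ => ?_
  rw [Finset.sum_comm]
  refine Finset.sum_congr rfl fun z _ => ?_
  rw [← Finset.sum_mul]
  by_cases hx : x ∈ X
  swap
  · simp [chi_zero_left hR hx]
  by_cases hz : z ∈ Z
  swap
  · simp [chi_zero_right hS hz]
  rw [h.sum_one' hC hX hZ hx hz, one_mul]

theorem quad (hC : IsCC ℛ) {X Y W Z : Set V} (hX : Fb ℛ m X) (hY : Fb ℛ m Y) (hW : Fb ℛ m W)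
    (hZ : Fb ℛ m Z) {s : ℕ}
    {R S R' S' : Set (V × V)} (hR : R ∈ relsBtw ℛ X Y) (hS : S ∈ relsBtw ℛ Y Z)
    (hR' : R' ∈ relsBtw ℛ X W) (hS' : S' ∈ relsBtw ℛ W Z)
    {ρ σ : Fin (s+1) → Set (V × V)} (h : Enm ℛ X Z s ρ) (h' : Enm ℛ Y W s σ) :
    ∑ c, NN R S (ρ c) * NN R' S' (ρ c) / outDeg (ρ c) =
    ∑ c, NN (transp R) R' (σ c) * NN S (transp S') (σ c) / outDeg (σ c) := by
  apply Nat.eq_of_mul_eq_mul_left hX.pos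
  rw [half hC hX hZ hR hS hR' hS' h,
    half hC hY hW (transp_mem hC hR) hR' hS (transp_mem hC hS') h']
  simp only [chi_transp, Finset.sum_mul_sum]
  have a1 : ∀ x, ∑ z, ∑ y, ∑ w, chi R x y * chi S y z * (chi R' x w * chi S' w z) =
      ∑ y, ∑ w, ∑ z, chi R x y * chi R' x w * (chi S y z * chi S' w z) := by
    intro x
    rw [Finset.sum_comm]
    refine Finset.sum_congr rfl fun y _ => ?_
    rw [Finset.sum_comm]
    refine Finset.sum_congr rfl fun w _ => Finset.sum_congr rfl fun z _ => ?_
    ring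
  simp only [a1]
  rw [Finset.sum_comm]
  refine Finset.sum_congr rfl fun y _ => ?_
  rw [Finset.sum_comm]

theorem enm_exists {X Y : Set V} {s : ℕ} (h : Nat.card (relsBtw ℛ X Y) = s + 1)
    (key : Set (V × V) → ℕ) :
    ∃ ρ : Fin (s+1) → Set (V × V), Enm ℛ X Y s ρ ∧ Monotone (fun a => key (ρ a)) := by
  have : Finite (relsBtw ℛ X Y) := Nat.finite_of_card_ne_zero (by omega)
  let e := Finite.equivFinOfCardEq h
  let f : Fin (s+1) → ℕ := fun a => key (e.symm a).1
  refine ⟨fun a => (e.symm (Tuple.sort f a)).1, ⟨?_, ?_, ?_⟩, Tuple.monotone_sort f⟩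
  · intro a b hab
    exact (Tuple.sort f).injective (e.symm.injective (Subtype.ext hab))
  · intro a
    exact (e.symm (Tuple.sort f a)).2
  · intro R hR
    refine ⟨(Tuple.sort f).symm (e ⟨R, hR⟩), ?_⟩
    simp

theorem diag_mem {X : Set V} (hX : Fb ℛ m X) : diag X ∈ relsBtw ℛ X X :=
  ⟨hX.1.2, fun p hp => ⟨hp.1, by rw [← hp.2]; exact hp.1⟩⟩

theorem out_diag (hC : IsCC ℛ) {X : Set V} (hX : Fb ℛ m X) : outDeg (diag X) = 1 := by
  obtain ⟨x, hx⟩ := hX.1.1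
  rw [← out_eq hC hX (diag_mem hX) x hx]
  simp [chi, diag, hx]

theorem enm_diag (hC : IsCC ℛ) {X : Set V} (hX : Fb ℛ m X) {s : ℕ}
    (h : Nat.card (relsBtw ℛ X X) = s + 1) :
    ∃ ρ : Fin (s+1) → Set (V × V), Enm ℛ X X s ρ ∧ Monotone (fun a => outDeg (ρ a)) ∧
      ρ 0 = diag X := by
  obtain ⟨ρ, hρ, hm⟩ := enm_exists h (fun R => if R = diag X then 0 else outDeg R)
  refine ⟨ρ, hρ, ?_, ?_⟩
  · intro a b hab
    have := hm hab
    simp only at this ⊢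
    by_cases ha : ρ a = diag X
    · rw [ha, out_diag hC hX]
      exact out_pos hC hX (hρ.mem b)
    · have := out_pos hC hX (hρ.mem a)
      by_cases hb : ρ b = diag X
      · simp [ha, hb] at *; omega
      · simp [ha, hb] at *; omega
  · obtain ⟨a, ha⟩ := hρ.surj _ (diag_mem hX)
    have := hm (Fin.zero_le a)
    simp only [ha, if_true] at this
    by_contra hne
    have := out_pos hC hX (hρ.mem 0)
    simp [hne] at *
    omega

theorem Enm.transp (hC : IsCC ℛ) {X Y : Set V} {s : ℕ} {ρ : Fin (s+1) → Set (V × V)}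
    (h : Enm ℛ X Y s ρ) : Enm ℛ Y X s (fun a => transp (ρ a)) := by
  refine ⟨?_, fun a => transp_mem hC (h.mem a), ?_⟩
  · intro a b hab
    apply h.inj
    have : CCPaper.transp (CCPaper.transp (ρ a)) = CCPaper.transp (CCPaper.transp (ρ b)) :=
      congrArg _ hab
    exact this
  · intro R hR
    obtain ⟨a, ha⟩ := h.surj _ (transp_mem hC hR)
    exact ⟨a, by rw [ha]; rfl⟩

theorem rho_exists (hC : IsCC ℛ) {s : ℕ} (F : Fin 3 → Set V) (hF : ∀ i, Fb ℛ m (F i))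
    (hc : ∀ i j, Nat.card (relsBtw ℛ (F i) (F j)) = s + 1) :
    ∃ ρ : Fin 3 → Fin 3 → Fin (s+1) → Set (V × V),
      (∀ i j, Enm ℛ (F i) (F j) s (ρ i j)) ∧
      (∀ i j, Monotone (fun a => outDeg (ρ i j a))) ∧
      (∀ i, ρ i i 0 = diag (F i)) ∧
      (∀ i j, i ≠ j → ∀ a, ρ j i a = transp (ρ i j a)) := by
  have h1 : ∀ i j, ∃ ρ : Fin (s+1) → Set (V × V), Enm ℛ (F i) (F j) s ρ ∧
      Monotone (fun a => outDeg (ρ a)) := fun i j => enm_exists (hc i j) outDeg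
  have h2 := fun i => enm_diag hC (hF i) (hc i i)
  choose σ hσ hσm using h1
  choose α hα hαm hα0 using h2
  refine ⟨fun i j a => if i = j then α i a else if i < j then σ i j a else transp (σ j i a),
    ?_, ?_, ?_, ?_⟩
  · intro i j
    by_cases hij : i = j
    · subst hij; simpa using hα i
    · by_cases hlt : i < j
      · simpa [hij, hlt] using hσ i j
      · simpa [hij, hlt] using (hσ j i).transp hC
  · intro i j
    by_cases hij : i = j
    · subst hij; simpa using hαm i
    · by_cases hlt : i < j
      · simpa [hij, hlt] using hσm i j
      · have e : ∀ a, outDeg (transp (σ j i a)) = outDeg (σ j i a) :=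
          fun a => out_transp hC (hF j) (hF i) ((hσ j i).mem a)
        simpa [hij, hlt, e] using hσm j i
  · intro i; simpa using hα0 i
  · intro i j hij a
    by_cases hlt : i < j
    · have : ¬ j < i := by omega
      simp [hij, Ne.symm hij, hlt, this]
    · have : j < i := by omega
      simp [hij, Ne.symm hij, hlt, this, transp_transp]

theorem sys_exists (hC : IsCC ℛ) {s : ℕ} (F : Fin 3 → Set V) (hF : ∀ i, Fb ℛ m (F i))
    (hc : ∀ i j, Nat.card (relsBtw ℛ (F i) (F j)) = s + 1) (hinj : Function.Injective F)
    (hred : IsReduced ℛ) : Nonempty (Sys m s) := by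
  obtain ⟨ρ, hρ, hmono, h0, ht⟩ := rho_exists hC F hF hc
  have dsy : ∀ i j, i ≠ j → ∀ a, outDeg (ρ j i a) = outDeg (ρ i j a) := by
    intro i j hij a
    rw [ht i j hij, out_transp hC (hF i) (hF j) ((hρ i j).mem a)]
  have tm : ∀ i j a, transp (ρ i j a) ∈ relsBtw ℛ (F j) (F i) :=
    fun i j a => transp_mem hC ((hρ i j).mem a)
  have tout : ∀ i j a, outDeg (transp (ρ i j a)) = outDeg (ρ i j a) :=
    fun i j a => out_transp hC (hF i) (hF j) ((hρ i j).mem a)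
  refine ⟨{
    d := fun i j a => outDeg (ρ i j a)
    e := fun i a => outDeg (ρ i i a)
    U := fun i j a b x => NN (transp (ρ i j a)) (ρ i j b) (ρ j j x)
    N := fun i j k a b c => NN (ρ i j a) (ρ j k b) (ρ i k c)
    d2 := ?_
    dm := fun i j _ => hmono i j
    em := fun i => hmono i i
    e0 := ?_
    ds := fun i j _ => (hρ i j).sum_deg hC (hF i) (hF j)
    es := fun i => (hρ i i).sum_deg hC (hF i) (hF i)
    dsymm := fun i j hij => funext (dsy i j hij)
    U0 := ?_
    Uk := ?_
    Ub := ?_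
    Ua := ?_
    Ud := ?_
    Nc := fun i j k _ _ _ a b => marg3 hC (hF i) (hF j) (hF k) ((hρ i j).mem a) ((hρ j k).mem b) (hρ i k)
    Nb := fun i j k _ _ _ a b => marg2 hC (hF i) (hF j) (hF k) ((hρ i j).mem a) ((hρ i k).mem b) (hρ j k)
    Na := fun i j k _ _ _ a b => marg1 hC (hF i) (hF j) (hF k) ((hρ j k).mem a) ((hρ i k).mem b) (hρ i j)
    Nd := fun i j k _ _ _ a b c => NN_dvd hC (hF i) (hF j) ((hρ i j).mem a) ((hρ j k).mem b) ((hρ i k).mem c)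
    Q1 := ?_
    Q2 := ?_ }⟩
  · intro i j hij a
    have hR := (hρ i j).mem a
    have h1 := out_pos hC (hF i) hR
    have h2 := hred (F i) (F j) (hF i).1 (hF j).1 (fun h => hij (hinj h)) _ hR
    have h3 := in_out hC (hF i) (hF j) hR
    have h4 : outDeg (ρ i j a) ≠ 1 := fun h => h2 ⟨h, by rw [h3, h]⟩
    show 2 ≤ outDeg (ρ i j a)
    omega
  · intro i
    show outDeg (ρ i i 0) = 1
    rw [h0, out_diag hC (hF i)]
  · intro i j hij a b
    show NN (transp (ρ i j a)) (ρ i j b) (ρ j j 0) = _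
    rw [h0, NN_diag hC (hF i) (hF j) ((hρ i j).mem a) ((hρ i j).mem b)]
    simp only [(hρ i j).inj.eq_iff]
  · intro i j hij a b
    have := marg3 hC (hF j) (hF i) (hF j) (tm i j a) ((hρ i j).mem b) (hρ j j)
    rw [tout] at this; exact this
  · intro i j hij a b
    have := marg2 hC (hF j) (hF i) (hF j) (tm i j a) ((hρ j j).mem b) (hρ i j)
    rw [tout] at this; exact this
  · intro i j hij a b
    exact marg1 hC (hF j) (hF i) (hF j) ((hρ i j).mem a) ((hρ j j).mem b) ((hρ i j).transp hC)
  · intro i j hij a b k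
    have := NN_dvd hC (hF j) (hF i) (tm i j a) ((hρ i j).mem b) ((hρ j j).mem k)
    rw [tout] at this; exact this
  · intro i j k hij hjk hik a b
    have := quad hC (hF i) (hF j) (hF j) (hF k) ((hρ i j).mem a) ((hρ j k).mem b) ((hρ i j).mem a)
      ((hρ j k).mem b) (hρ i k) (hρ j j)
    simp only [ht j k hjk, transp_transp]
    exact this
  · intro i j hij a b
    have := quad hC (hF j) (hF i) (hF i) (hF j) (tm i j a) ((hρ i j).mem b) (tm i j a)
      ((hρ i j).mem b) (hρ j j) (hρ i i)
    simp only [ht i j hij]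
    exact this

end SchemePart

/-- **Theorem (Statement 5).** If `𝒞` is a reduced `(m,n,r)`-scheme with `m ≤ 11`,
then `n ≤ 2`. -/
theorem reduced_m_le_eleven
    {V : Type*} [Fintype V] [Nonempty V]
    (ℛ : Set (Set (V × V))) (m n r : ℕ)
    (h : IsMNRScheme ℛ m n r) (hred : IsReduced ℛ) (hm : m ≤ 11) :
    n ≤ 2 := by
  obtain ⟨hC, hB, hM, hn⟩ := h
  by_contra hlt
  have hfin : Finite {X : Set V | IsFiber ℛ X} := Nat.finite_of_card_ne_zero (by omega)
  let e := Finite.equivFinOfCardEq hn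
  let F : Fin 3 → Set V := fun i => (e.symm (Fin.castLE (by omega) i)).1
  have hinj : Function.Injective F := by
    intro i j hij
    exact Fin.castLE_injective _ (e.symm.injective (Subtype.ext hij))
  have hF1 : ∀ i, IsFiber ℛ (F i) := fun i => (e.symm (Fin.castLE (by omega) i)).2
  have hF : ∀ i, Fb ℛ m (F i) := fun i => ⟨hF1 i, hM _ (hF1 i)⟩
  have hr : r ≠ 0 := by
    have h1 := hB (F 0) (F 0) (hF1 0) (hF1 0)
    have : Nonempty (relsBtw ℛ (F 0) (F 0)) := ⟨⟨_, diag_mem (hF 0)⟩⟩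
    rw [← h1]
    exact Nat.card_pos.ne'
  obtain ⟨s, rfl⟩ := Nat.exists_eq_succ_of_ne_zero hr
  obtain ⟨S⟩ := sys_exists hC F hF (fun i j => hB _ _ (hF1 i) (hF1 j)) hinj hred
  exact S.false_of_le hm

end CCPaper
end
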